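/- arXiv:2504.13046 — 9 statements merged into one kernel-verified Lean document; each statement's English description precedes it below -/
import Mathlib

section
/- Let p ≥ 1, ρ ≥ 0 and λ > ρ. Let T : ℝ^p → Set ℝ^p be ρ-co-hypomonotone, and let J : ℝ^p → ℝ^p satisfy x − J x ∈ λ • T (J x) for every x ∈ ℝ^p (a single-valued resolvent of λT). Define the Moreau–Yosida approximation A x := (1/λ)(x − J x). Then for all x, y ∈ ℝ^p one has ⟪A x − A y, x − y⟫ ≥ (λ − ρ)‖A x − A y‖²; that is, A is (λ − ρ)-co-coercive. -/
open scoped RealInnerProductSpace Pointwise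

/-- The Moreau–Yosida approximation `A x = (1/λ)(x − J x)` of a `ρ`-co-hypomonotone operator
`T` (with single-valued resolvent `J` of `λT`, `λ > ρ`) is `(λ − ρ)`-co-coercive. -/
theorem stmt_0 (p : ℕ) (hp : 1 ≤ p) (ρ lam : ℝ) (hρ : 0 ≤ ρ) (hlam : ρ < lam)
    (T : EuclideanSpace ℝ (Fin p) → Set (EuclideanSpace ℝ (Fin p)))
    (hT : ∀ x y u v, u ∈ T x → v ∈ T y → ⟪u - v, x - y⟫ ≥ -ρ * ‖u - v‖ ^ 2)
    (J : EuclideanSpace ℝ (Fin p) → EuclideanSpace ℝ (Fin p))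
    (hJ : ∀ x, x - J x ∈ lam • T (J x))
    (A : EuclideanSpace ℝ (Fin p) → EuclideanSpace ℝ (Fin p))
    (hA : ∀ x, A x = (1 / lam) • (x - J x)) :
    ∀ x y, ⟪A x - A y, x - y⟫ ≥ (lam - ρ) * ‖A x - A y‖ ^ 2 := by
  have hlam0 : lam ≠ 0 := (hρ.trans_lt hlam).ne'
  have hJA : ∀ x, J x = x - lam • A x := fun x => by
    rw [hA, smul_smul, mul_one_div_cancel hlam0, one_smul, sub_sub_cancel]
  have hmem : ∀ x, A x ∈ T (J x) := fun x => by
    rw [hA, one_div]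
    exact (Set.mem_smul_set_iff_inv_smul_mem₀ hlam0 _ _).1 (hJ x)
  intro x y
  have h := hT _ _ _ _ (hmem x) (hmem y)
  have hsub : J x - J y = (x - y) - lam • (A x - A y) := by
    rw [hJA x, hJA y]
    module
  rw [hsub, inner_sub_right, real_inner_smul_right, real_inner_self_eq_norm_sq] at h
  linarith
end

section
/- Let p ≥ 1, ρ ≥ 0 and λ > 0 with λ ≥ 2ρ. Let T : ℝ^p → Set ℝ^p be ρ-co-hypomonotone, and let J : ℝ^p → ℝ^p satisfy x − J x ∈ λ • T (J x) for every x ∈ ℝ^p. Then J is nonexpansive: ‖J x − J y‖ ≤ ‖x − y‖ for all x, y ∈ ℝ^p. -/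
open scoped RealInnerProductSpace Pointwise

/-- The resolvent `J` of `λT` for a `ρ`-co-hypomonotone operator `T` is nonexpansive
whenever `λ ≥ 2ρ`. -/
theorem stmt_1 (p : ℕ) (hp : 1 ≤ p) (ρ lam : ℝ) (hρ : 0 ≤ ρ) (hlam0 : 0 < lam)
    (hlam : 2 * ρ ≤ lam)
    (T : EuclideanSpace ℝ (Fin p) → Set (EuclideanSpace ℝ (Fin p)))
    (hT : ∀ x y u v, u ∈ T x → v ∈ T y → ⟪u - v, x - y⟫ ≥ -ρ * ‖u - v‖ ^ 2)
    (J : EuclideanSpace ℝ (Fin p) → EuclideanSpace ℝ (Fin p))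
    (hJ : ∀ x, x - J x ∈ lam • T (J x)) :
    ∀ x y, ‖J x - J y‖ ≤ ‖x - y‖ := by
  intro x y
  obtain ⟨u, hu, hxu⟩ := Set.mem_smul_set.mp (hJ x)
  obtain ⟨v, hv, hyv⟩ := Set.mem_smul_set.mp (hJ y)
  have hdecomp : x - y = (J x - J y) + lam • (u - v) := by
    rw [smul_sub, hxu, hyv]
    abel
  have hsq : ‖x - y‖ ^ 2 =
      ‖J x - J y‖ ^ 2 + 2 * (lam * ⟪u - v, J x - J y⟫) + lam ^ 2 * ‖u - v‖ ^ 2 := by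
    rw [hdecomp, norm_add_sq_real, real_inner_smul_right, real_inner_comm, norm_smul, mul_pow,
      Real.norm_eq_abs, sq_abs]
  have hinner := mul_le_mul_of_nonneg_left (hT _ _ _ _ hu hv) hlam0.le
  have hgap : 0 ≤ lam * (lam - 2 * ρ) * ‖u - v‖ ^ 2 :=
    mul_nonneg (mul_nonneg hlam0.le (sub_nonneg.mpr hlam)) (sq_nonneg _)
  refine (sq_le_sq₀ (norm_nonneg _) (norm_nonneg _)).mp ?_
  linarith
end

section
/- Let p ≥ 1, L > 0, ρ ≥ 0. Let F : ℝ^p → ℝ^p be (1/L)-co-coercive and T : ℝ^p → Set ℝ^p be ρ-co-hypomonotone. Let L̂ ≥ L with L̂ρ < 1, and let λ satisfy ρ < λ ≤ 2(1 + √(1 − L̂ρ))/L̂. Let J : ℝ^p → ℝ^p satisfy x − J x ∈ λ • T (J x) for every x ∈ ℝ^p. Set β̄ := (λ(4 − L̂λ) − 4ρ)/(4(1 − ρL̂)) and Λ := (L̂ − L)/(L·L̂), and define the forward–backward splitting residual G_λ x := (1/λ)(x − J(x − λ F x)). Then for all x, y ∈ ℝ^p: ⟪G_λ x − G_λ y,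 x − y⟫ ≥ β̄‖G_λ x − G_λ y‖² + Λ·L·⟪F x − F y, x − y⟫. -/
open scoped RealInnerProductSpace Pointwise

/-- Co-coercivity-type bound for the forward–backward splitting residual `G_λ`. -/
theorem stmt_2 (p : ℕ) (hp : 1 ≤ p) (L ρ Lhat lam : ℝ)
    (hL : 0 < L) (hρ : 0 ≤ ρ) (hLhat : L ≤ Lhat) (hLhatρ : Lhat * ρ < 1)
    (hlam1 : ρ < lam) (hlam2 : lam ≤ 2 * (1 + Real.sqrt (1 - Lhat * ρ)) / Lhat)
    (F : EuclideanSpace ℝ (Fin p) → EuclideanSpace ℝ (Fin p))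
    (hF : ∀ x y, ⟪F x - F y, x - y⟫ ≥ (1 / L) * ‖F x - F y‖ ^ 2)
    (T : EuclideanSpace ℝ (Fin p) → Set (EuclideanSpace ℝ (Fin p)))
    (hT : ∀ x y u v, u ∈ T x → v ∈ T y → ⟪u - v, x - y⟫ ≥ -ρ * ‖u - v‖ ^ 2)
    (J : EuclideanSpace ℝ (Fin p) → EuclideanSpace ℝ (Fin p))
    (hJ : ∀ x, x - J x ∈ lam • T (J x))
    (βbar Λ : ℝ)
    (hβbar : βbar = (lam * (4 - Lhat * lam) - 4 * ρ) / (4 * (1 - ρ * Lhat)))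
    (hΛ : Λ = (Lhat - L) / (L * Lhat))
    (G : EuclideanSpace ℝ (Fin p) → EuclideanSpace ℝ (Fin p))
    (hG : ∀ x, G x = (1 / lam) • (x - J (x - lam • F x))) :
    ∀ x y, ⟪G x - G y, x - y⟫ ≥ βbar * ‖G x - G y‖ ^ 2 + Λ * L * ⟪F x - F y, x - y⟫ := by
  have hM : 0 < Lhat := hL.trans_le hLhat
  have hlam : 0 < lam := hρ.trans_lt hlam1
  have ha : 0 < 1 - ρ * Lhat := by linarith [mul_comm ρ Lhat]
  have hres : ∀ x, J (x - lam • F x) = x - lam • G x := by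
    intro x
    rw [hG, smul_smul, mul_one_div_cancel hlam.ne', one_smul, sub_sub_cancel]
  have hmem : ∀ x, G x - F x ∈ T (x - lam • G x) := by
    intro x
    have h := hJ (x - lam • F x)
    rw [hres, Set.mem_smul_set_iff_inv_smul_mem₀ hlam.ne'] at h
    convert h using 1
    rw [sub_sub_sub_cancel_left, ← smul_sub, inv_smul_smul₀ hlam.ne']
  intro x y
  have hT' := hT _ _ _ _ (hmem x) (hmem y)
  have hF' := hF x y
  rw [show G x - F x - (G y - F y) = (G x - G y) - (F x - F y) by abel,
    show x - lam • G x - (y - lam • G y) = (x - y) - lam • (G x - G y) by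
      rw [smul_sub]; abel] at hT'
  generalize G x - G y = g at *
  generalize F x - F y = f at *
  generalize x - y = d at *
  have hsq : 0 ≤ ‖(2 * (1 - ρ * Lhat)) • f - (Lhat * (lam - 2 * ρ)) • g‖ ^ 2 := by positivity
  simp only [← real_inner_self_eq_norm_sq, inner_sub_left, inner_sub_right,
    real_inner_smul_left, real_inner_smul_right, real_inner_comm f g] at hT' hF' hsq ⊢
  have hF'' : 1 / Lhat * ⟪f, f⟫ ≤ L / Lhat * ⟪f, d⟫ := by
    have h := mul_le_mul_of_nonneg_left hF' (div_pos hL hM).le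
    rwa [← mul_assoc, show L / Lhat * (1 / L) = 1 / Lhat by field_simp] at h
  have hΛL : Λ * L = 1 - L / Lhat := by
    rw [hΛ]; field_simp
  have hβ : βbar = lam - ρ - Lhat * (lam - 2 * ρ) ^ 2 / (4 * (1 - ρ * Lhat)) := by
    rw [hβbar, eq_sub_iff_add_eq, ← add_div, div_eq_iff (by positivity)]
    ring
  have hquad : 0 ≤ (1 / Lhat - ρ) * ⟪f, f⟫ - (lam - 2 * ρ) * ⟪f, g⟫
      + Lhat * (lam - 2 * ρ) ^ 2 / (4 * (1 - ρ * Lhat)) * ⟪g, g⟫ := by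
    have h := div_nonneg hsq (by positivity : 0 ≤ 4 * (1 - ρ * Lhat) * Lhat)
    refine h.trans_eq ?_
    rw [div_eq_iff (by positivity)]
    generalize h1 : 1 / Lhat = c
    generalize h2 : Lhat * (lam - 2 * ρ) ^ 2 / (4 * (1 - ρ * Lhat)) = e
    have hc : c * Lhat = 1 := by rw [← h1, one_div_mul_cancel hM.ne']
    have he : e * (4 * (1 - ρ * Lhat)) = Lhat * (lam - 2 * ρ) ^ 2 := by
      rw [← h2, div_mul_cancel₀ _ (by positivity)]
    linear_combination -4 * (1 - ρ * Lhat) * ⟪f, f⟫ * hc - Lhat * ⟪g, g⟫ * he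
  rw [hΛL, hβ]
  linarith
end

section
/- Let p ≥ 1, L > 0, ρ ≥ 0. Let F : ℝ^p → ℝ^p be (1/L)-co-coercive and T : ℝ^p → Set ℝ^p be ρ-co-hypomonotone. Let L̂ ≥ L with L̂ρ < 1, and let λ satisfy ρ < λ ≤ 2(1 + √(1 − L̂ρ))/L̂. Let J : ℝ^p → ℝ^p satisfy x − J x ∈ λ • T (J x) for every x ∈ ℝ^p. Set β̄ := (λ(4 − L̂λ) − 4ρ)/(4(1 − ρL̂)) and Λ := (L̂ − L)/(L·L̂), and define the backward–forward splitting residual S_λ u := F(J u) + (1/λ)(u − J u). Then for all u, v ∈ ℝ^p: ⟪S_λ u − S_λ v, u − v⟫ ≥ β̄‖S_λ u − S_λ v‖² + Λ·L·⟪F(J u) − F(J v), J u − J v⟫. -/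
open scoped RealInnerProductSpace Pointwise

/-- With the optimal modulus, the quadratic form arising in backward–forward splitting is a
perfect square. -/
theorem mul_norm_add_sq_le_of_bfs_modulus {E : Type*} [NormedAddCommGroup E]
    [InnerProductSpace ℝ E] {K ρ lam : ℝ} (hK : 0 < K) (hKρ : K * ρ < 1) (a b : E) :
    (lam * (4 - K * lam) - 4 * ρ) / (4 * (1 - ρ * K)) * ‖a + b‖ ^ 2 ≤
      (1 / K) * ‖a‖ ^ 2 + lam * ⟪a, b⟫ + (lam - ρ) * ‖b‖ ^ 2 := by
  have hpos : 0 < 1 - ρ * K := by linarith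
  have hne : 1 - K * ρ ≠ 0 := (sub_pos.mpr hKρ).ne'
  have hsq : 0 ≤ ‖(K * lam - 2) • a + (K * (lam - 2 * ρ)) • b‖ ^ 2 / (4 * K * (1 - ρ * K)) := by
    positivity
  rw [norm_add_sq_real, norm_smul, norm_smul, mul_pow, mul_pow, Real.norm_eq_abs,
    Real.norm_eq_abs, sq_abs, sq_abs, real_inner_smul_left, real_inner_smul_right] at hsq
  rw [norm_add_sq_real, ← sub_nonneg]
  convert hsq using 1
  field_simp
  ring

/-- Co-coercivity-type bound for the backward–forward splitting residual `S_λ`. -/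
theorem stmt_3 (p : ℕ) (hp : 1 ≤ p) (L ρ Lhat lam : ℝ)
    (hL : 0 < L) (hρ : 0 ≤ ρ) (hLhat : L ≤ Lhat) (hLhatρ : Lhat * ρ < 1)
    (hlam1 : ρ < lam) (hlam2 : lam ≤ 2 * (1 + Real.sqrt (1 - Lhat * ρ)) / Lhat)
    (F : EuclideanSpace ℝ (Fin p) → EuclideanSpace ℝ (Fin p))
    (hF : ∀ x y, ⟪F x - F y, x - y⟫ ≥ (1 / L) * ‖F x - F y‖ ^ 2)
    (T : EuclideanSpace ℝ (Fin p) → Set (EuclideanSpace ℝ (Fin p)))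
    (hT : ∀ x y u v, u ∈ T x → v ∈ T y → ⟪u - v, x - y⟫ ≥ -ρ * ‖u - v‖ ^ 2)
    (J : EuclideanSpace ℝ (Fin p) → EuclideanSpace ℝ (Fin p))
    (hJ : ∀ x, x - J x ∈ lam • T (J x))
    (βbar Λ : ℝ)
    (hβbar : βbar = (lam * (4 - Lhat * lam) - 4 * ρ) / (4 * (1 - ρ * Lhat)))
    (hΛ : Λ = (Lhat - L) / (L * Lhat))
    (S : EuclideanSpace ℝ (Fin p) → EuclideanSpace ℝ (Fin p))
    (hS : ∀ u, S u = F (J u) + (1 / lam) • (u - J u)) :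
    ∀ u v, ⟪S u - S v, u - v⟫ ≥ βbar * ‖S u - S v‖ ^ 2
      + Λ * L * ⟪F (J u) - F (J v), J u - J v⟫ := by
  intro u v
  have hK : 0 < Lhat := hL.trans_le hLhat
  obtain ⟨s, hs, hsu⟩ := Set.mem_smul_set.mp (hJ u)
  obtain ⟨t, ht, htv⟩ := Set.mem_smul_set.mp (hJ v)
  have hlam : lam ≠ 0 := (hρ.trans_lt hlam1).ne'
  have hSd : S u - S v = (F (J u) - F (J v)) + (s - t) := by
    rw [hS, hS, ← hsu, ← htv, smul_smul, smul_smul, one_div_mul_cancel hlam, one_smul, one_smul]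
    abel
  have huv : u - v = (J u - J v) + lam • (s - t) := by
    rw [smul_sub, hsu, htv]
    abel
  have hmono := hT (J u) (J v) s t hs ht
  have hcoc := mul_le_mul_of_nonneg_left (hF (J u) (J v)) (div_pos hL hK).le
  have hform := mul_norm_add_sq_le_of_bfs_modulus (lam := lam) hK hLhatρ
    (F (J u) - F (J v)) (s - t)
  rw [← hβbar] at hform
  have hcoef : L / Lhat * (1 / L * ‖F (J u) - F (J v)‖ ^ 2) =
      1 / Lhat * ‖F (J u) - F (J v)‖ ^ 2 := by
    field_simp
  have hΛL : Λ * L = 1 - L / Lhat := by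
    rw [hΛ]
    field_simp
  rw [hcoef] at hcoc
  rw [hSd, huv, hΛL, inner_add_left, inner_add_right, inner_add_right, real_inner_smul_right,
    real_inner_smul_right, real_inner_self_eq_norm_sq]
  linarith
end

section
/- Let p ≥ 1, L > 0, ρ ≥ 0, L̂ ≥ L with L̂ρ < 1, and 2ρ ≤ λ ≤ 2(1 + √(1 − L̂ρ))/L̂ with λ > ρ. Let F : ℝ^p → ℝ^p be (1/L)-co-coercive, T : ℝ^p → Set ℝ^p be ρ-co-hypomonotone, J : ℝ^p → ℝ^p a single-valued resolvent of λT, G_λ x := (1/λ)(x − J(x − λ F x)), β̄ := (λ(4 − L̂λ) − 4ρ)/(4(1 − ρL̂)), Λ := (L̂ − L)/(L·L̂). Fix μ ∈ (0,1], ν ∈ (0,1), β > 0, r ≥ 2 + 1/μ, s > 0, and set t_k := μ(k + r), η_k := 2β(t_k − 1)/(t_k − ν). Let x⋆ ∈ ℝ^p with G_λ x⋆ = 0, and let sequences x^k, z^k, F̃^k ∈ ℝ^p (k ≥ 0) satisfy for all k ≥ 0: y^k = ((t_k − 1)x^k + z^k)/t_k, G̃^k = (1/λ)(x^k − J(x^k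 − λ F̃^k)), x^{k+1} = y^k − η_k G̃^k, z^{k+1} = z^k + ν(x^{k+1} − y^k). Set e^k := F̃^k − F x^k, ℰ_{k+1} := L⟪F x^{k+1} − F x^k, x^{k+1} − x^k⟫, a_k := t_{k−1}(t_{k−1} − 1 − s(1 − ν)), c_k := (1 − μ)[(t_k − ν)(t_{k−1} − 1) + μ(1 − ν)]/(2(t_{k−1} − 1)(t_k − 1)), and ℒ_k := β a_k‖G_λ x^k‖² + t_{k−1}⟪G_λ x^k, x^k − z^k⟫ + (c_k/(2νβ))‖z^k − x⋆‖². Then for every k ≥ 0: ℒ_k − ℒ_{k+1} ≥ β φ_k‖G_λ x^k‖² + (1 − μ)⟪G_λ x^k, x^k − x⋆⟫ + Λ t_k(t_k − 1)ℰ_{k+1} + [β̄ − (1 + s)β] t_k(t_k − 1)‖G_λ x^{k+1} − G_λ x^k‖² − ψ_k‖e^k‖², where φ_k := t_{k−1}[t_{k−1} − 1 − s(1 − ν)] − ((t_k − 1)/(t_k − ν))[t_k(t_k − 2 + ν − s(1 − ν)) + 2(1 − μ)ν] and ψ_k := β(t_k − 1)[t_k(t_k − 1)/(s(t_k − ν))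 + 2ν(1 − μ)/(t_k − ν) + (1 − μ)ν(t_{k−1} − 1)/(μ(1 − ν))]. -/
open scoped RealInnerProductSpace Pointwise

section HilbertSpace

variable {E : Type*} [NormedAddCommGroup E] [InnerProductSpace ℝ E]

/-- Weighted Young inequality for the inner product. -/
lemma weighted_young {a b c : ℝ} (ha : 0 < a) (habc : b ^ 2 ≤ a * c) (u v : E) :
    0 ≤ a * ‖u‖ ^ 2 + 2 * b * ⟪u, v⟫ + c * ‖v‖ ^ 2 := by
  have h := norm_add_sq_real (a • u) (b • v)
  simp only [norm_smul, mul_pow, Real.norm_eq_abs, sq_abs, real_inner_smul_left,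
    real_inner_smul_right] at h
  refine nonneg_of_mul_nonneg_right ?_ ha
  nlinarith [sq_nonneg ‖a • u + b • v‖, mul_le_mul_of_nonneg_right habc (sq_nonneg ‖v‖)]

/-- A single-valued resolvent of a co-hypomonotone map is nonexpansive. -/
lemma resolvent_nonexpansive {ρ lam : ℝ} (hlam : 0 ≤ lam) (hρ : 2 * ρ ≤ lam) {T : E → Set E}
    (hT : ∀ a b u v, u ∈ T a → v ∈ T b → ⟪u - v, a - b⟫ ≥ -ρ * ‖u - v‖ ^ 2)
    {J : E → E} (hJ : ∀ a, a - J a ∈ lam • T (J a)) (a b : E) :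
    ‖J a - J b‖ ^ 2 ≤ ‖a - b‖ ^ 2 := by
  obtain ⟨u, hu, hua⟩ := Set.mem_smul_set.1 (hJ a)
  obtain ⟨v, hv, hvb⟩ := Set.mem_smul_set.1 (hJ b)
  have h := hT _ _ u v hu hv
  have hab : a - b = lam • (u - v) + (J a - J b) := by
    rw [smul_sub, hua, hvb]; abel
  rw [hab, norm_add_sq_real, norm_smul, mul_pow, Real.norm_eq_abs, sq_abs, real_inner_smul_left]
  nlinarith [mul_le_mul_of_nonneg_left h hlam,
    mul_nonneg (mul_nonneg hlam (sub_nonneg.2 hρ)) (sq_nonneg ‖u - v‖)]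

/-- Co-coercivity-type estimate for the forward-backward splitting residual. -/
lemma residual_cocoercive {L ρ Lhat lam : ℝ} (hL : 0 < L) (hLhat : L ≤ Lhat)
    (hLhatρ : Lhat * ρ < 1) (hlam : 0 < lam) {F : E → E}
    (hF : ∀ a b, ⟪F a - F b, a - b⟫ ≥ (1 / L) * ‖F a - F b‖ ^ 2) {T : E → Set E}
    (hT : ∀ a b u v, u ∈ T a → v ∈ T b → ⟪u - v, a - b⟫ ≥ -ρ * ‖u - v‖ ^ 2)
    {J : E → E} (hJ : ∀ a, a - J a ∈ lam • T (J a)) {G : E → E}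
    (hG : ∀ a, G a = (1 / lam) • (a - J (a - lam • F a))) (a b : E) :
    (lam * (4 - Lhat * lam) - 4 * ρ) / (4 * (1 - ρ * Lhat)) * ‖G a - G b‖ ^ 2
      + (Lhat - L) / (L * Lhat) * (L * ⟪F a - F b, a - b⟫) ≤ ⟪G a - G b, a - b⟫ := by
  have hLh : 0 < Lhat := hL.trans_le hLhat
  have hJG (c : E) : J (c - lam • F c) = c - lam • G c := by
    rw [hG, smul_smul, mul_one_div_cancel hlam.ne', one_smul]; abel
  have hmem (c : E) : G c - F c ∈ T (c - lam • G c) := by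
    obtain ⟨u, hu, h⟩ := Set.mem_smul_set.1 (hJ (c - lam • F c))
    rw [hJG] at hu h
    have : lam • u = lam • (G c - F c) := by rw [h, smul_sub]; abel
    rwa [smul_right_injective E hlam.ne' this] at hu
  have h := hT _ _ _ _ (hmem a) (hmem b)
  set g := G a - G b with hg
  set f := F a - F b with hf
  have h1 : G a - F a - (G b - F b) = g - f := by rw [hg, hf]; abel
  have h2 : a - lam • G a - (b - lam • G b) = (a - b) - lam • g := by
    rw [hg, smul_sub]; abel
  rw [h1, h2, norm_sub_sq_real, inner_sub_right, inner_sub_left g f, inner_sub_left g f,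
    real_inner_smul_right, real_inner_smul_right, real_inner_self_eq_norm_sq,
    real_inner_comm g f] at h
  have hfa : 1 / Lhat * ‖f‖ ^ 2 ≤ L / Lhat * ⟪f, a - b⟫ := by
    have := mul_le_mul_of_nonneg_left (hF a b) (div_pos hL hLh).le
    calc 1 / Lhat * ‖f‖ ^ 2 = L / Lhat * (1 / L * ‖f‖ ^ 2) := by field_simp
      _ ≤ _ := this
  have hd : 0 < 1 - ρ * Lhat := by linarith [mul_comm Lhat ρ]
  have hpos : 0 < 1 / Lhat - ρ := by
    have : 1 / Lhat - ρ = (1 - ρ * Lhat) / Lhat := by field_simp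
    rw [this]; positivity
  have hy := weighted_young (a := 1 / Lhat - ρ) (b := -(lam - 2 * ρ) / 2)
    (c := Lhat * (lam - 2 * ρ) ^ 2 / (4 * (1 - ρ * Lhat))) hpos
    (le_of_eq (by field_simp; ring)) f g
  have hcoef : (lam * (4 - Lhat * lam) - 4 * ρ) / (4 * (1 - ρ * Lhat))
      = lam - ρ - Lhat * (lam - 2 * ρ) ^ 2 / (4 * (1 - ρ * Lhat)) := by
    rw [eq_sub_iff_add_eq, ← add_div, div_eq_iff (by positivity)]; ring
  have hcoef' : (Lhat - L) / (L * Lhat) * (L * ⟪f, a - b⟫)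
      = ⟪f, a - b⟫ - L / Lhat * ⟪f, a - b⟫ := by
    field_simp
  rw [real_inner_comm f g] at h
  rw [hcoef, hcoef']
  linarith

/-- Perfect-square estimate relating two consecutive residuals `g`, `g'` and the error `e`. -/
lemma consecutive_residual_bound {t ν s : ℝ} (hν : ν < t) (hs : 0 < s) (g g' e : E) :
    0 ≤ -(t - 1 - s * (1 - ν)) * ‖g'‖ ^ 2 + 2 * (t - 1) * ⟪g', g + e⟫
      - 2 * ((t - 1) / (t - ν)) * (t - 1) * ⟪g, g + e⟫
      + (t - 1) / (t - ν) * (t - 2 + ν - s * (1 - ν)) * ‖g‖ ^ 2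
      + (1 + s) * (t - 1) * ‖g' - g‖ ^ 2 + (t - 1) ^ 2 / (s * (t - ν)) * ‖e‖ ^ 2 := by
  have ht : 0 < t - ν := sub_pos.2 hν
  have hy := weighted_young (a := s * (t - ν)) (b := t - 1) (c := (t - 1) ^ 2 / (s * (t - ν)))
    (mul_pos hs ht) (le_of_eq (by field_simp)) (g' - ((t - 1) / (t - ν)) • g) e
  rw [norm_sub_sq_real, norm_smul, mul_pow, Real.norm_eq_abs, sq_abs, inner_sub_left,
    real_inner_smul_left, real_inner_smul_right] at hy
  rw [norm_sub_sq_real, inner_add_right, inner_add_right, real_inner_self_eq_norm_sq]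
  refine hy.trans_eq ?_
  field_simp
  ring

/-- One-step Lyapunov descent for the accelerated scheme, in terms of the residuals `g`, `g'` at
two consecutive iterates `x`, `x'` and the inexact residual `g + e`; here `m` is any lower bound
for `⟪g' - g, x' - x⟫`. -/
lemma lyapunov_descent {t μ ν β s m : ℝ} (hμ0 : 0 < μ) (hμ1 : μ ≤ 1) (hν0 : 0 < ν) (hν1 : ν < 1)
    (hβ : 0 < β) (hs : 0 < s) (ht : 1 + μ < t) {g g' e x x' z z' xstar : E}
    (hx' : x' = (1 / t) • ((t - 1) • x + z) - (2 * β * (t - 1) / (t - ν)) • (g + e))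
    (hz' : z' = z - (ν * (2 * β * (t - 1) / (t - ν))) • (g + e))
    (hm : m ≤ ⟪g' - g, x' - x⟫) :
    β * ((t - μ) * (t - μ - 1 - s * (1 - ν))
          - (t - 1) / (t - ν) * (t * (t - 2 + ν - s * (1 - ν)) + 2 * (1 - μ) * ν)) * ‖g‖ ^ 2
        + (1 - μ) * ⟪g, x - xstar⟫ + t * (t - 1) * m
        - (1 + s) * β * (t * (t - 1)) * ‖g' - g‖ ^ 2
        - β * (t - 1) * (t * (t - 1) / (s * (t - ν)) + 2 * ν * (1 - μ) / (t - ν)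
          + (1 - μ) * ν * (t - μ - 1) / (μ * (1 - ν))) * ‖e‖ ^ 2
      ≤ (β * ((t - μ) * (t - μ - 1 - s * (1 - ν))) * ‖g‖ ^ 2 + (t - μ) * ⟪g, x - z⟫
          + (1 - μ) * (t - μ - ν) / (2 * (t - μ - 1)) / (2 * ν * β) * ‖z - xstar‖ ^ 2)
        - (β * (t * (t - 1 - s * (1 - ν))) * ‖g'‖ ^ 2 + t * ⟪g', x' - z'⟫
          + (1 - μ) * (t - ν) / (2 * (t - 1)) / (2 * ν * β) * ‖z' - xstar‖ ^ 2) := by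
  have ht0 : 0 < t := by linarith
  have ht1 : 0 < t - 1 := by linarith
  have htμ : 0 < t - μ - 1 := by linarith
  have htν : 0 < t - ν := by linarith
  have hν' : 0 < 1 - ν := by linarith
  have hμ' : 0 ≤ 1 - μ := by linarith
  have hw : x' - x = -(1 / t) • (x - z) - (2 * β * (t - 1) / (t - ν)) • (g + e) := by
    rw [hx']
    match_scalars <;> field_simp <;> ring
  have hxz : x' - z' = ((t - 1) / t) • (x - z)
      - ((1 - ν) * (2 * β * (t - 1) / (t - ν))) • (g + e) := by
    rw [hx', hz']
    match_scalars <;> field_simp <;> ring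
  have hzs : z' - xstar = (z - xstar) - (ν * (2 * β * (t - 1) / (t - ν))) • (g + e) := by
    rw [hz']; abel
  have hxs : x - z = (x - xstar) - (z - xstar) := by abel
  rw [hw] at hm
  rw [hxz, hzs]
  rw [hxs] at hm ⊢
  generalize x - xstar = d at *
  generalize z - xstar = q at *
  have hm' := mul_le_mul_of_nonneg_left hm (mul_pos ht0 ht1).le
  have hQ1 := mul_nonneg hμ' (weighted_young
    (a := (1 - ν) * μ / (4 * ν * β * (t - μ - 1) * (t - 1))) (b := 1 / 2)
    (c := ν * β * (t - μ - 1) * (t - 1) / (μ * (1 - ν)))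
    (by positivity) (le_of_eq (by field_simp; norm_num)) q e)
  have hQ2 : 0 ≤ (1 - μ) * ν * β * (t - 1) / (t - ν) * ‖g - e‖ ^ 2 := by positivity
  have hQ3 := mul_nonneg (mul_pos hβ ht0).le (consecutive_residual_bound (sub_pos.1 htν) hs g g' e)
  have hqg : ⟪g, q⟫ = ⟪q, g⟫ := real_inner_comm _ _
  have hgg' : ⟪g', g⟫ = ⟪g, g'⟫ := real_inner_comm _ _
  simp only [norm_sub_sq_real, norm_add_sq_real, norm_smul, mul_pow, Real.norm_eq_abs, sq_abs,
    inner_add_right, inner_sub_left, inner_sub_right, real_inner_smul_right,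
    real_inner_self_eq_norm_sq, hqg, hgg'] at hm' hQ1 hQ2 hQ3 ⊢
  rw [← sub_nonneg] at hm' ⊢
  refine (add_nonneg (add_nonneg (add_nonneg hm' hQ1) hQ2) hQ3).trans_eq ?_
  field_simp
  ring

end HilbertSpace

/-- One-iteration descent property of the Lyapunov function `ℒ_k` for the VFOSA₊
(variance-reduced fast forward–backward splitting) iteration. -/
theorem stmt_4 (p : ℕ) (hp : 1 ≤ p) (L ρ Lhat lam μ ν β r s : ℝ)
    (hL : 0 < L) (hρ : 0 ≤ ρ) (hLhat : L ≤ Lhat) (hLhatρ : Lhat * ρ < 1)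
    (hlam0 : 2 * ρ ≤ lam) (hlam1 : ρ < lam)
    (hlam2 : lam ≤ 2 * (1 + Real.sqrt (1 - Lhat * ρ)) / Lhat)
    (hμ0 : 0 < μ) (hμ1 : μ ≤ 1) (hν0 : 0 < ν) (hν1 : ν < 1)
    (hβ : 0 < β) (hr : r ≥ 2 + 1 / μ) (hs : 0 < s)
    (F : EuclideanSpace ℝ (Fin p) → EuclideanSpace ℝ (Fin p))
    (hF : ∀ a b, ⟪F a - F b, a - b⟫ ≥ (1 / L) * ‖F a - F b‖ ^ 2)
    (T : EuclideanSpace ℝ (Fin p) → Set (EuclideanSpace ℝ (Fin p)))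
    (hT : ∀ a b u v, u ∈ T a → v ∈ T b → ⟪u - v, a - b⟫ ≥ -ρ * ‖u - v‖ ^ 2)
    (J : EuclideanSpace ℝ (Fin p) → EuclideanSpace ℝ (Fin p))
    (hJ : ∀ a, a - J a ∈ lam • T (J a))
    (G : EuclideanSpace ℝ (Fin p) → EuclideanSpace ℝ (Fin p))
    (hG : ∀ a, G a = (1 / lam) • (a - J (a - lam • F a)))
    (βbar Λ : ℝ)
    (hβbar : βbar = (lam * (4 - Lhat * lam) - 4 * ρ) / (4 * (1 - ρ * Lhat)))
    (hΛ : Λ = (Lhat - L) / (L * Lhat))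
    (xstar : EuclideanSpace ℝ (Fin p)) (hxstar : G xstar = 0)
    (x z y Gt Ft : ℕ → EuclideanSpace ℝ (Fin p))
    (hy : ∀ k : ℕ,
      y k = (1 / (μ * ((k : ℝ) + r))) • ((μ * ((k : ℝ) + r) - 1) • x k + z k))
    (hGt : ∀ k : ℕ, Gt k = (1 / lam) • (x k - J (x k - lam • Ft k)))
    (hx : ∀ k : ℕ,
      x (k + 1) = y k - (2 * β * (μ * ((k : ℝ) + r) - 1) / (μ * ((k : ℝ) + r) - ν)) • Gt k)
    (hz : ∀ k : ℕ, z (k + 1) = z k + ν • (x (k + 1) - y k))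
    (Lfun : ℕ → ℝ)
    (hLfun : ∀ k : ℕ, Lfun k =
      β * ((μ * ((k : ℝ) + r - 1)) * (μ * ((k : ℝ) + r - 1) - 1 - s * (1 - ν)))
          * ‖G (x k)‖ ^ 2
      + (μ * ((k : ℝ) + r - 1)) * ⟪G (x k), x k - z k⟫
      + ((1 - μ) * ((μ * ((k : ℝ) + r) - ν) * (μ * ((k : ℝ) + r - 1) - 1) + μ * (1 - ν))
          / (2 * (μ * ((k : ℝ) + r - 1) - 1) * (μ * ((k : ℝ) + r) - 1))) / (2 * ν * β)
        * ‖z k - xstar‖ ^ 2) :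
    ∀ k : ℕ,
      Lfun k - Lfun (k + 1) ≥
        β * ((μ * ((k : ℝ) + r - 1)) * (μ * ((k : ℝ) + r - 1) - 1 - s * (1 - ν))
              - ((μ * ((k : ℝ) + r) - 1) / (μ * ((k : ℝ) + r) - ν))
                * ((μ * ((k : ℝ) + r)) * (μ * ((k : ℝ) + r) - 2 + ν - s * (1 - ν))
                   + 2 * (1 - μ) * ν)) * ‖G (x k)‖ ^ 2
        + (1 - μ) * ⟪G (x k), x k - xstar⟫
        + Λ * (μ * ((k : ℝ) + r)) * (μ * ((k : ℝ) + r) - 1)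
            * (L * ⟪F (x (k + 1)) - F (x k), x (k + 1) - x k⟫)
        + (βbar - (1 + s) * β) * (μ * ((k : ℝ) + r)) * (μ * ((k : ℝ) + r) - 1)
            * ‖G (x (k + 1)) - G (x k)‖ ^ 2
        - β * (μ * ((k : ℝ) + r) - 1)
            * ((μ * ((k : ℝ) + r)) * (μ * ((k : ℝ) + r) - 1) / (s * (μ * ((k : ℝ) + r) - ν))
               + 2 * ν * (1 - μ) / (μ * ((k : ℝ) + r) - ν)
               + (1 - μ) * ν * (μ * ((k : ℝ) + r - 1) - 1) / (μ * (1 - ν)))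
            * ‖Ft k - F (x k)‖ ^ 2 := by
  intro k
  have hlam : 0 < lam := hρ.trans_lt hlam1
  have hμr : 1 + 2 * μ ≤ μ * r := by
    have := mul_le_mul_of_nonneg_left hr hμ0.le
    rw [mul_add, mul_one_div_cancel hμ0.ne'] at this
    linarith
  have hμk : 0 ≤ μ * (k : ℝ) := by positivity
  obtain ⟨t, ht⟩ : ∃ t, t = μ * ((k : ℝ) + r) := ⟨_, rfl⟩
  have htp : μ * ((k : ℝ) + r - 1) = t - μ := by rw [ht]; ring
  have hsucc : μ * (((k + 1 : ℕ) : ℝ) + r) = t + μ := by rw [ht]; push_cast; ring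
  have hsuccp : μ * (((k + 1 : ℕ) : ℝ) + r - 1) = t := by rw [ht]; push_cast; ring
  have htμ : 1 + μ < t := by rw [ht]; linarith
  have hyk := hy k
  have hxk := hx k
  rw [hLfun k, hLfun (k + 1), hsucc, hsuccp]
  simp only [← ht, htp] at hyk hxk ⊢
  have he : ‖Gt k - G (x k)‖ ^ 2 ≤ ‖Ft k - F (x k)‖ ^ 2 := by
    have h := resolvent_nonexpansive hlam.le hlam0 hT hJ (x k - lam • F (x k)) (x k - lam • Ft k)
    have h1 : x k - lam • F (x k) - (x k - lam • Ft k) = lam • (Ft k - F (x k)) := by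
      rw [smul_sub]; abel
    have h2 : J (x k - lam • F (x k)) - J (x k - lam • Ft k) = lam • (Gt k - G (x k)) := by
      rw [hGt, hG, ← smul_sub, smul_smul, mul_one_div_cancel hlam.ne', one_smul]; abel
    rw [h1, h2, norm_smul, norm_smul, mul_pow, mul_pow] at h
    exact le_of_mul_le_mul_left h (by rw [Real.norm_eq_abs, sq_abs]; positivity)
  have hm := residual_cocoercive hL hLhat hLhatρ hlam hF hT hJ hG (x (k + 1)) (x k)
  rw [← hβbar, ← hΛ] at hm
  have hGe : Gt k = G (x k) + (Gt k - G (x k)) := by abel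
  have hx' : x (k + 1) = (1 / t) • ((t - 1) • x k + z k)
      - (2 * β * (t - 1) / (t - ν)) • (G (x k) + (Gt k - G (x k))) := by
    rw [← hGe, hxk, hyk]
  have hz' : z (k + 1) = z k
      - (ν * (2 * β * (t - 1) / (t - ν))) • (G (x k) + (Gt k - G (x k))) := by
    rw [← hGe, hz, hxk, mul_smul, sub_sub_cancel_left, smul_neg, ← sub_eq_add_neg]
  have key := lyapunov_descent (xstar := xstar) hμ0 hμ1 hν0 hν1 hβ hs htμ hx' hz' hm
  have hc : (1 - μ) * ((t - ν) * (t - μ - 1) + μ * (1 - ν)) / (2 * (t - μ - 1) * (t - 1))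
      = (1 - μ) * (t - μ - ν) / (2 * (t - μ - 1)) := by
    have h1 : t - μ - 1 ≠ 0 := by apply ne_of_gt; linarith
    have h2 : t - 1 ≠ 0 := by apply ne_of_gt; linarith
    field_simp
    ring
  have hc' : (1 - μ) * ((t + μ - ν) * (t - 1) + μ * (1 - ν)) / (2 * (t - 1) * (t + μ - 1))
      = (1 - μ) * (t - ν) / (2 * (t - 1)) := by
    have h1 : t + μ - 1 ≠ 0 := by apply ne_of_gt; linarith
    have h2 : t - 1 ≠ 0 := by apply ne_of_gt; linarith
    field_simp
    ring
  have hψ : 0 ≤ β * (t - 1) * (t * (t - 1) / (s * (t - ν)) + 2 * ν * (1 - μ) / (t - ν)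
      + (1 - μ) * ν * (t - μ - 1) / (μ * (1 - ν))) := by
    have h0 : 0 < t := by linarith
    have h1 : 0 < t - 1 := by linarith
    have h2 : 0 < t - ν := by linarith
    have h3 : 0 < t - μ - 1 := by linarith
    have h4 : 0 < 1 - ν := by linarith
    have h5 : 0 ≤ 1 - μ := by linarith
    positivity
  have hψe := mul_le_mul_of_nonneg_left he hψ
  rw [hc, hc']
  linarith
end

section
/- Let p ≥ 1, L > 0, ρ ≥ 0, L̂ ≥ L with L̂ρ < 1, and ρ < λ ≤ 2(1 + √(1 − L̂ρ))/L̂. Let F : ℝ^p → ℝ^p be (1/L)-co-coercive, T : ℝ^p → Set ℝ^p be ρ-co-hypomonotone, J : ℝ^p → ℝ^p a single-valued resolvent of λT, G_λ x := (1/λ)(x − J(x − λ F x)), β̄ := (λ(4 − L̂λ) − 4ρ)/(4(1 − ρL̂)). Fix μ ∈ (0,1], ν ∈ (0,1), β > 0, r ≥ 2 + 1/μ, s > 0, and set t_k := μ(k + r). Let x⋆ ∈ ℝ^p with G_λ x⋆ = 0. For any k ≥ 0 and any points x^k, z^k ∈ ℝ^p, define a_k := t_{k−1}(t_{k−1} −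 1 − s(1 − ν)), c_k := (1 − μ)[(t_k − ν)(t_{k−1} − 1) + μ(1 − ν)]/(2(t_{k−1} − 1)(t_k − 1)), and ℒ_k := β a_k‖G_λ x^k‖² + t_{k−1}⟪G_λ x^k, x^k − z^k⟫ + (c_k/(2νβ))‖z^k − x⋆‖². Then ℒ_k ≥ (A_k/2)‖G_λ x^k‖² + (((t_{k−1} − 1)[(1 − μ − 2ν)t_k + ν(1 + μ)] + μ(1 − μ)(1 − ν))/(4νβ(t_{k−1} − 1)(t_k − 1)))‖z^k − x⋆‖², where A_k := β t_{k−1}[t_{k−1} − 2 − 2s(1 − ν)] + 2β̄ t_{k−1}. -/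
open scoped RealInnerProductSpace Pointwise

/-- The quadratic lower bound behind the co-coercivity of the forward-backward residual: from
co-hypomonotonicity and co-coercivity increments `g`, `f`, `d` of the residual, the forward operator
and the point. -/
lemma cocoercive_residual_increment {E : Type*} [NormedAddCommGroup E] [InnerProductSpace ℝ E]
    {K ρ lam : ℝ} (hK : 0 < K) (hKρ : K * ρ < 1) (g f d : E)
    (hT : ⟪g - f, d - lam • g⟫ ≥ -ρ * ‖g - f‖ ^ 2) (hF : ⟪f, d⟫ ≥ (1 / K) * ‖f‖ ^ 2) :
    (lam * (4 - K * lam) - 4 * ρ) / (4 * (1 - ρ * K)) * ‖g‖ ^ 2 ≤ ⟪g, d⟫ := by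
  have hpos : 0 < 1 - ρ * K := by linarith [mul_comm K ρ]
  have hsq : 0 ≤ ‖(2 * (1 - ρ * K)) • f - (K * (lam - 2 * ρ)) • g‖ ^ 2 := sq_nonneg _
  rw [norm_sub_sq_real, norm_smul, norm_smul, mul_pow, mul_pow, Real.norm_eq_abs,
    Real.norm_eq_abs, sq_abs, sq_abs, inner_smul_left, inner_smul_right] at hsq
  simp only [conj_trivial] at hsq
  rw [norm_sub_sq_real, inner_sub_left, inner_sub_right, inner_sub_right, inner_smul_right,
    inner_smul_right, real_inner_self_eq_norm_sq, real_inner_comm f g] at hT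
  have hne : 1 - K * ρ ≠ 0 := (sub_pos.mpr hKρ).ne'
  have key : (1 / K) * ‖f‖ ^ 2 - ρ * ‖f‖ ^ 2 - (lam - 2 * ρ) * ⟪f, g⟫ + (lam - ρ) * ‖g‖ ^ 2
      - (lam * (4 - K * lam) - 4 * ρ) / (4 * (1 - ρ * K)) * ‖g‖ ^ 2
      = ((2 * (1 - ρ * K)) ^ 2 * ‖f‖ ^ 2
          - 2 * (2 * (1 - ρ * K) * (K * (lam - 2 * ρ) * ⟪f, g⟫))
          + (K * (lam - 2 * ρ)) ^ 2 * ‖g‖ ^ 2) / (4 * K * (1 - ρ * K)) := by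
    field_simp
    ring
  have hnonneg := div_nonneg hsq (by positivity : 0 ≤ 4 * K * (1 - ρ * K))
  rw [← key] at hnonneg
  linarith

/-- Young's inequality for the real inner product, with weights adapted to `t` and `β`. -/
lemma mul_inner_le_young {E : Type*} [NormedAddCommGroup E] [InnerProductSpace ℝ E]
    {β : ℝ} (hβ : 0 < β) (t : ℝ) (g w : E) :
    t * ⟪g, w⟫ ≤ β * t ^ 2 / 2 * ‖g‖ ^ 2 + 1 / (2 * β) * ‖w‖ ^ 2 := by
  have hsq : 0 ≤ ‖(β * t) • g - w‖ ^ 2 := sq_nonneg _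
  rw [norm_sub_sq_real, norm_smul, mul_pow, Real.norm_eq_abs, sq_abs, inner_smul_left] at hsq
  simp only [conj_trivial] at hsq
  have key : β * t ^ 2 / 2 * ‖g‖ ^ 2 + 1 / (2 * β) * ‖w‖ ^ 2 - t * ⟪g, w⟫
      = ((β * t) ^ 2 * ‖g‖ ^ 2 - 2 * (β * t * ⟪g, w⟫) + ‖w‖ ^ 2) / (2 * β) := by
    field_simp
    ring
  have hnonneg := div_nonneg hsq (by positivity : 0 ≤ 2 * β)
  rw [← key] at hnonneg
  linarith

/-- Lower bound for the Lyapunov function `ℒ_k` of the VFOSA₊ method. -/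
theorem stmt_5 (p : ℕ) (hp : 1 ≤ p) (L ρ Lhat lam μ ν β r s : ℝ)
    (hL : 0 < L) (hρ : 0 ≤ ρ) (hLhat : L ≤ Lhat) (hLhatρ : Lhat * ρ < 1)
    (hlam1 : ρ < lam) (hlam2 : lam ≤ 2 * (1 + Real.sqrt (1 - Lhat * ρ)) / Lhat)
    (hμ0 : 0 < μ) (hμ1 : μ ≤ 1) (hν0 : 0 < ν) (hν1 : ν < 1)
    (hβ : 0 < β) (hr : r ≥ 2 + 1 / μ) (hs : 0 < s)
    (F : EuclideanSpace ℝ (Fin p) → EuclideanSpace ℝ (Fin p))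
    (hF : ∀ a b, ⟪F a - F b, a - b⟫ ≥ (1 / L) * ‖F a - F b‖ ^ 2)
    (T : EuclideanSpace ℝ (Fin p) → Set (EuclideanSpace ℝ (Fin p)))
    (hT : ∀ a b u v, u ∈ T a → v ∈ T b → ⟪u - v, a - b⟫ ≥ -ρ * ‖u - v‖ ^ 2)
    (J : EuclideanSpace ℝ (Fin p) → EuclideanSpace ℝ (Fin p))
    (hJ : ∀ a, a - J a ∈ lam • T (J a))
    (G : EuclideanSpace ℝ (Fin p) → EuclideanSpace ℝ (Fin p))
    (hG : ∀ a, G a = (1 / lam) • (a - J (a - lam • F a)))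
    (βbar : ℝ)
    (hβbar : βbar = (lam * (4 - Lhat * lam) - 4 * ρ) / (4 * (1 - ρ * Lhat)))
    (xstar : EuclideanSpace ℝ (Fin p)) (hxstar : G xstar = 0)
    (k : ℕ) (xk zk : EuclideanSpace ℝ (Fin p)) :
    β * ((μ * ((k : ℝ) + r - 1)) * (μ * ((k : ℝ) + r - 1) - 1 - s * (1 - ν))) * ‖G xk‖ ^ 2
      + (μ * ((k : ℝ) + r - 1)) * ⟪G xk, xk - zk⟫
      + ((1 - μ) * ((μ * ((k : ℝ) + r) - ν) * (μ * ((k : ℝ) + r - 1) - 1) + μ * (1 - ν))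
          / (2 * (μ * ((k : ℝ) + r - 1) - 1) * (μ * ((k : ℝ) + r) - 1))) / (2 * ν * β)
        * ‖zk - xstar‖ ^ 2
    ≥ ((β * (μ * ((k : ℝ) + r - 1)) * (μ * ((k : ℝ) + r - 1) - 2 - 2 * s * (1 - ν))
          + 2 * βbar * (μ * ((k : ℝ) + r - 1))) / 2) * ‖G xk‖ ^ 2
      + (((μ * ((k : ℝ) + r - 1) - 1) * ((1 - μ - 2 * ν) * (μ * ((k : ℝ) + r)) + ν * (1 + μ))
            + μ * (1 - μ) * (1 - ν))
          / (4 * ν * β * (μ * ((k : ℝ) + r - 1) - 1) * (μ * ((k : ℝ) + r) - 1)))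
        * ‖zk - xstar‖ ^ 2 := by
  have hlam : 0 < lam := hρ.trans_lt hlam1
  have hK : 0 < Lhat := hL.trans_le hLhat
  have hsel : ∀ a, G a - F a ∈ T (a - lam • G a) := by
    intro a
    have hJa : J (a - lam • F a) = a - lam • G a := by
      rw [hG a, smul_smul, mul_one_div_cancel hlam.ne', one_smul, sub_sub_cancel]
    obtain ⟨u, hu, hu_eq⟩ := Set.mem_smul_set.mp (hJ (a - lam • F a))
    rw [hJa] at hu hu_eq
    have hlu : lam • u = lam • (G a - F a) := by
      rw [hu_eq, smul_sub]
      abel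
    rwa [← smul_right_injective _ hlam.ne' hlu]
  have hres : βbar * ‖G xk‖ ^ 2 ≤ ⟪G xk, xk - xstar⟫ := by
    rw [hβbar]
    refine cocoercive_residual_increment hK hLhatρ (G xk) (F xk - F xstar) (xk - xstar) ?_ ?_
    · have h := hT _ _ _ _ (hsel xk) (hsel xstar)
      rw [hxstar] at h
      have hu : G xk - F xk - (0 - F xstar) = G xk - (F xk - F xstar) := by abel
      have hx : xk - lam • G xk - (xstar - lam • 0) = xk - xstar - lam • G xk := by
        rw [smul_zero]
        abel
      rwa [hu, hx] at h
    · exact (mul_le_mul_of_nonneg_right (one_div_le_one_div_of_le hL hLhat)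
        (sq_nonneg _)).trans (hF xk xstar)
  have ht : 1 < μ * ((k : ℝ) + r - 1) := by
    have hμr : μ * (2 + 1 / μ) ≤ μ * r := mul_le_mul_of_nonneg_left hr hμ0.le
    have hμk : 0 ≤ μ * (k : ℝ) := by positivity
    have hexp : μ * (2 + 1 / μ) = 2 * μ + 1 := by field_simp
    linarith
  have ht' : μ * ((k : ℝ) + r) = μ * ((k : ℝ) + r - 1) + μ := by ring
  rw [ht']
  generalize μ * ((k : ℝ) + r - 1) = t at ht
  have hinner : ⟪G xk, xk - zk⟫ = ⟪G xk, xk - xstar⟫ - ⟪G xk, zk - xstar⟫ := by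
    rw [← inner_sub_right, sub_sub_sub_cancel_right]
  have hyoung := mul_inner_le_young hβ t (G xk) (zk - xstar)
  have hcoef : ((1 - μ) * ((t + μ - ν) * (t - 1) + μ * (1 - ν))
          / (2 * (t - 1) * (t + μ - 1))) / (2 * ν * β)
      = ((t - 1) * ((1 - μ - 2 * ν) * (t + μ) + ν * (1 + μ)) + μ * (1 - μ) * (1 - ν))
          / (4 * ν * β * (t - 1) * (t + μ - 1)) + 1 / (2 * β) := by
    have h1 : t - 1 ≠ 0 := by linarith
    have h2 : t + μ - 1 ≠ 0 := by linarith
    field_simp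
    ring
  rw [hinner, hcoef]
  have hmul : t * (βbar * ‖G xk‖ ^ 2) ≤ t * ⟪G xk, xk - xstar⟫ :=
    mul_le_mul_of_nonneg_left hres (by linarith)
  linarith
end

section
/- Let (Ω, ℙ) be a probability space, p ≥ 1, τ ∈ [0,1], b > 0, Ē ≥ 0, δ ≥ 0, and let e⁻ ∈ ℝ^p be a fixed vector. Let X, Y : Ω → ℝ^p be integrable random vectors (not necessarily independent) with E[X] = 0, E[Y] = 0, E‖X‖² ≤ Ē/b, and E‖Y‖² ≤ δ². Then E‖(1 − τ)·e⁻ + (1 − τ)·X + τ·Y‖² ≤ (1 − τ)²‖e⁻‖² + (2(1 − τ)²/b)·Ē + 2τ²δ². -/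
open MeasureTheory

/-- Expanding the square around `u` and bounding the square of the remaining sum by convexity. -/
lemma norm_add_add_sq_le {E : Type*} [NormedAddCommGroup E] [InnerProductSpace ℝ E]
    (u v w : E) :
    ‖u + v + w‖ ^ 2 ≤ ‖u‖ ^ 2 + 2 * inner ℝ u (v + w) + (2 * ‖v‖ ^ 2 + 2 * ‖w‖ ^ 2) := by
  have h := parallelogram_law_with_norm ℝ v w
  rw [add_assoc, norm_add_sq_real]
  nlinarith [mul_self_nonneg ‖v - w‖]

/-- The second moment of a vector plus two centered random vectors, with no independence. -/
lemma integral_norm_add_add_sq_le {E Ω : Type*} [NormedAddCommGroup E] [InnerProductSpace ℝ E]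
    [CompleteSpace E] [MeasurableSpace Ω] {μ : Measure Ω} [IsProbabilityMeasure μ]
    (u : E) {V W : Ω → E} (hV : Integrable V μ) (hW : Integrable W μ)
    (hV2 : Integrable (fun ω => ‖V ω‖ ^ 2) μ) (hW2 : Integrable (fun ω => ‖W ω‖ ^ 2) μ)
    (hV0 : ∫ ω, V ω ∂μ = 0) (hW0 : ∫ ω, W ω ∂μ = 0) :
    ∫ ω, ‖u + V ω + W ω‖ ^ 2 ∂μ
      ≤ ‖u‖ ^ 2 + 2 * ∫ ω, ‖V ω‖ ^ 2 ∂μ + 2 * ∫ ω, ‖W ω‖ ^ 2 ∂μ := by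
  have hVW : Integrable (fun ω => V ω + W ω) μ := hV.add hW
  have hinner : Integrable (fun ω => 2 * inner ℝ u (V ω + W ω)) μ :=
    (hVW.const_inner u).const_mul 2
  have hlin : Integrable (fun ω => ‖u‖ ^ 2 + 2 * inner ℝ u (V ω + W ω)) μ :=
    (integrable_const _).add hinner
  have hquad : Integrable (fun ω => 2 * ‖V ω‖ ^ 2 + 2 * ‖W ω‖ ^ 2) μ :=
    (hV2.const_mul 2).add (hW2.const_mul 2)
  calc ∫ ω, ‖u + V ω + W ω‖ ^ 2 ∂μ
      ≤ ∫ ω, (‖u‖ ^ 2 + 2 * inner ℝ u (V ω + W ω)) + (2 * ‖V ω‖ ^ 2 + 2 * ‖W ω‖ ^ 2) ∂μ :=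
        integral_mono_of_nonneg (.of_forall fun _ => sq_nonneg _) (hlin.add hquad)
          (.of_forall fun _ => norm_add_add_sq_le _ _ _)
    _ = ‖u‖ ^ 2 + 2 * ∫ ω, ‖V ω‖ ^ 2 ∂μ + 2 * ∫ ω, ‖W ω‖ ^ 2 ∂μ := by
        rw [integral_add hlin hquad, integral_add (integrable_const _) hinner,
          integral_add (hV2.const_mul 2) (hW2.const_mul 2), integral_const_mul,
          integral_const_mul, integral_const_mul, integral_inner hVW, integral_add hV hW,
          hV0, hW0]
        simp [add_assoc]

/-- One-step variance bound for the HSGD estimator with possibly dependent batches. -/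
theorem stmt_8 (p : ℕ) (hp : 1 ≤ p)
    {Ω : Type*} [MeasurableSpace Ω] (ℙ : Measure Ω) [IsProbabilityMeasure ℙ]
    (τ b Ebar δ : ℝ) (hτ0 : 0 ≤ τ) (hτ1 : τ ≤ 1) (hb : 0 < b) (hE : 0 ≤ Ebar) (hδ : 0 ≤ δ)
    (em : EuclideanSpace ℝ (Fin p))
    (X Y : Ω → EuclideanSpace ℝ (Fin p))
    (hXi : Integrable X ℙ) (hYi : Integrable Y ℙ)
    (hXi2 : Integrable (fun ω => ‖X ω‖ ^ 2) ℙ)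
    (hYi2 : Integrable (fun ω => ‖Y ω‖ ^ 2) ℙ)
    (hXm : ∫ ω, X ω ∂ℙ = 0) (hYm : ∫ ω, Y ω ∂ℙ = 0)
    (hX2 : ∫ ω, ‖X ω‖ ^ 2 ∂ℙ ≤ Ebar / b) (hY2 : ∫ ω, ‖Y ω‖ ^ 2 ∂ℙ ≤ δ ^ 2) :
    ∫ ω, ‖(1 - τ) • em + (1 - τ) • X ω + τ • Y ω‖ ^ 2 ∂ℙ
      ≤ (1 - τ) ^ 2 * ‖em‖ ^ 2 + (2 * (1 - τ) ^ 2 / b) * Ebar + 2 * τ ^ 2 * δ ^ 2 := by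
  have h2 (c : ℝ) (v : EuclideanSpace ℝ (Fin p)) : ‖c • v‖ ^ 2 = c ^ 2 * ‖v‖ ^ 2 := by
    rw [norm_smul, mul_pow, Real.norm_eq_abs, sq_abs]
  have h := integral_norm_add_add_sq_le (μ := ℙ) ((1 - τ) • em)
    (V := fun ω => (1 - τ) • X ω) (W := fun ω => τ • Y ω) (hXi.fun_smul _) (hYi.fun_smul _)
    (by simpa only [h2] using hXi2.const_mul _) (by simpa only [h2] using hYi2.const_mul _)
    (by rw [integral_smul, hXm, smul_zero]) (by rw [integral_smul, hYm, smul_zero])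
  simp only [h2 _ em, h2 _ (X _), h2 _ (Y _), integral_const_mul] at h
  have hX := mul_le_mul_of_nonneg_left hX2 (sq_nonneg (1 - τ))
  have hY := mul_le_mul_of_nonneg_left hY2 (sq_nonneg τ)
  have hEb : 2 * (1 - τ) ^ 2 / b * Ebar = 2 * ((1 - τ) ^ 2 * (Ebar / b)) := by ring
  linarith
end

section
/- Let 𝕋 be a real p × p matrix, s ∈ ℝ^p, and ρ ≥ 0. If the symmetric matrix 𝕋 + 𝕋ᵀ + 2ρ·𝕋ᵀ𝕋 is positive semidefinite, then the affine map T x := 𝕋x + s is ρ-co-hypomonotone: ⟪T x − T y, x − y⟫ ≥ −ρ‖T x − T y‖² for all x, y ∈ ℝ^p. -/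
open Matrix
open scoped RealInnerProductSpace

/-- The transpose of a real matrix acts as the adjoint for the Euclidean inner product. -/
theorem inner_toEuclideanLin_transpose {m n : Type*} [Fintype m] [DecidableEq m] [Fintype n]
    [DecidableEq n] (A : Matrix m n ℝ) (x : EuclideanSpace ℝ m) (y : EuclideanSpace ℝ n) :
    ⟪Matrix.toEuclideanLin Aᵀ x, y⟫ = ⟪x, Matrix.toEuclideanLin A y⟫ := by
  rw [← Matrix.conjTranspose_eq_transpose_of_trivial,
    Matrix.toEuclideanLin_conjTranspose_eq_adjoint, LinearMap.adjoint_inner_left]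

/-- If `𝕋 + 𝕋ᵀ + 2ρ𝕋ᵀ𝕋` is positive semidefinite, then the affine map `x ↦ 𝕋x + s`
is `ρ`-co-hypomonotone. -/
theorem stmt_9 (p : ℕ) (M : Matrix (Fin p) (Fin p) ℝ) (s : EuclideanSpace ℝ (Fin p))
    (ρ : ℝ) (hρ : 0 ≤ ρ)
    (hpsd : ∀ z : EuclideanSpace ℝ (Fin p),
      0 ≤ ⟪Matrix.toEuclideanLin (M + Mᵀ + (2 * ρ) • (Mᵀ * M)) z, z⟫)
    (T : EuclideanSpace ℝ (Fin p) → EuclideanSpace ℝ (Fin p))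
    (hT : ∀ x, T x = Matrix.toEuclideanLin M x + s) :
    ∀ x y, ⟪T x - T y, x - y⟫ ≥ -ρ * ‖T x - T y‖ ^ 2 := by
  intro x y
  have hdiff : T x - T y = Matrix.toEuclideanLin M (x - y) := by
    rw [hT, hT, map_sub, add_sub_add_right_eq_sub]
  have hmul (z : EuclideanSpace ℝ (Fin p)) : Matrix.toEuclideanLin (Mᵀ * M) z =
      Matrix.toEuclideanLin Mᵀ (Matrix.toEuclideanLin M z) := by
    simp [Matrix.toLpLin_apply, Matrix.mulVec_mulVec]
  have h := hpsd (x - y)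
  rw [map_add, map_add, map_smul, LinearMap.add_apply, LinearMap.add_apply,
    LinearMap.smul_apply, inner_add_left, inner_add_left, real_inner_smul_left, hmul,
    inner_toEuclideanLin_transpose, inner_toEuclideanLin_transpose,
    real_inner_self_eq_norm_sq, real_inner_comm (Matrix.toEuclideanLin M (x - y)) (x - y)] at h
  rw [hdiff]
  linarith
end

section
/- Consider the FBS setting: L > 0, ρ ≥ 0 with Lρ < 1, F : ℝ^p → ℝ^p is (1/L)-co-coercive, T : ℝ^p → Set ℝ^p is ρ-co-hypomonotone, J : ℝ^p → ℝ^p is a single-valued resolvent of λT, G_λ x := (1/λ)(x − J(x − λ F x)), and x⋆ ∈ ℝ^p satisfies G_λ x⋆ = 0. Let L̂ > L with L̂ρ < 1, β̄ := (λ(4 − L̂λ) − 4ρ)/(4(1 − ρL̂)), Λ := (L̂ − L)/(L·L̂), and choose 2ρ ≤ λ < 2(1 + √(1 − L̂ρ))/L̂, 0 < μ < 2/3, r ≥ 2 + 1/μ, ν := μ/2, 0 < β ≤ (2 − μ)β̄/(2 + μ), t_k := μ(k + r), η_k := 2β(t_k − 1)/(t_k − ν). On a probability space (Ω, 𝒜,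 ℙ) with filtration (ℱ_k)_{k≥0}, let (x^k, z^k) be ℱ_k-measurable random vectors in ℝ^p satisfying, almost surely for all k ≥ 0, the VFOSA₊ iteration y^k = ((t_k − 1)x^k + z^k)/t_k, x^{k+1} = y^k − η_k G̃^k with G̃^k := (1/λ)(x^k − J(x^k − λ F̃^k)), z^{k+1} = z^k + ν(x^{k+1} − y^k), started from a deterministic x^0 = z^0, where (F̃^k) satisfies the VR(Δ_k; κ_k, Θ_k, σ_k) property. Suppose there are Γ_k > 0 such that κ_k ≥ 1 − Γ_{k−1}t_{k−2}(t_{k−2} − 1)/(Γ_k t_{k−1}(t_{k−1} − 1)) + 5β/(μΓ_k) for all k ≥ 1, and Γ_kΘ_k ≤ 2Λ for all k ≥ 0. Then for every K ≥ 0: E‖G_λ x^K‖² ≤ 2(Ψ₀² + E₀² + B_{K−1})/(μ²(K + r − 1)²), where Ψ₀² := μ²r²‖G_λ x^0‖² + ((2r − 1)/(4β²(μr − 1)))‖x^0 − x⋆‖², E₀² := (μ r²(Γ₀μ + β)/(2β))σ₀², and B_K := (Λ/β)∑_{k=0}^{K} t_{k−1}(t_{k−1} − 1)σ_k²/Θ_k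 with B_{−1} := 0 and t_{−1} := μ(r − 1). -/
open MeasureTheory Filter
open scoped RealInnerProductSpace Pointwise

section

variable {E : Type*} [NormedAddCommGroup E] [InnerProductSpace ℝ E]

theorem norm_resolvent_sub_le {T : E → Set E} {J : E → E} {ρ lam : ℝ} (hlam0 : 0 < lam)
    (hlam : 2 * ρ ≤ lam)
    (hT : ∀ a b u v, u ∈ T a → v ∈ T b → ⟪u - v, a - b⟫ ≥ -ρ * ‖u - v‖ ^ 2)
    (hJ : ∀ a, a - J a ∈ lam • T (J a)) (a b : E) : ‖J a - J b‖ ≤ ‖a - b‖ := by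
  obtain ⟨u, hu, hua⟩ := Set.mem_smul_set.1 (hJ a)
  obtain ⟨v, hv, hvb⟩ := Set.mem_smul_set.1 (hJ b)
  have h := hT _ _ u v hu hv
  have hab : a - b = (J a - J b) + lam • (u - v) := by
    rw [smul_sub, hua, hvb]; abel
  have hn : ‖a - b‖ ^ 2 = ‖J a - J b‖ ^ 2 + 2 * (lam * ⟪u - v, J a - J b⟫)
      + lam ^ 2 * ‖u - v‖ ^ 2 := by
    rw [hab, norm_add_sq_real, real_inner_smul_right, norm_smul, mul_pow, Real.norm_eq_abs,
      sq_abs, real_inner_comm]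
  refine le_of_sq_le_sq ?_ (norm_nonneg _)
  nlinarith [mul_le_mul_of_nonneg_left h hlam0.le,
    mul_nonneg (mul_nonneg hlam0.le (sub_nonneg.2 hlam)) (sq_nonneg ‖u - v‖)]

theorem forwardBackward_inner_ge {F J G : E → E} {T : E → Set E} {L Lhat ρ lam : ℝ}
    (hL : 0 < L) (hLhat : L < Lhat) (hLhatρ : Lhat * ρ < 1) (hlam0 : 0 < lam)
    (hF : ∀ a b, ⟪F a - F b, a - b⟫ ≥ (1 / L) * ‖F a - F b‖ ^ 2)
    (hT : ∀ a b u v, u ∈ T a → v ∈ T b → ⟪u - v, a - b⟫ ≥ -ρ * ‖u - v‖ ^ 2)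
    (hJ : ∀ a, a - J a ∈ lam • T (J a))
    (hG : ∀ a, G a = (1 / lam) • (a - J (a - lam • F a))) (a b : E) :
    (lam * (4 - Lhat * lam) - 4 * ρ) / (4 * (1 - ρ * Lhat)) * ‖G a - G b‖ ^ 2
      + (Lhat - L) / (L * Lhat) * (L * ⟪F a - F b, a - b⟫) ≤ ⟪G a - G b, a - b⟫ := by
  have hLh : 0 < Lhat := hL.trans hLhat
  have hD : 0 < 1 - ρ * Lhat := by linarith
  have hres : ∀ c, G c - F c ∈ T (J (c - lam • F c)) ∧ J (c - lam • F c) = c - lam • G c := by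
    intro c
    have hc : lam • G c = c - J (c - lam • F c) := by
      rw [hG, smul_smul, mul_one_div_cancel hlam0.ne', one_smul]
    refine ⟨?_, by rw [hc]; abel⟩
    obtain ⟨u, hu, huc⟩ := Set.mem_smul_set.1 (hJ (c - lam • F c))
    have : u = G c - F c := by
      have h2 : lam • u = lam • (G c - F c) := by
        rw [huc, smul_sub, hc]; abel
      exact smul_right_injective E hlam0.ne' h2
    exact this ▸ hu
  obtain ⟨ha, ha'⟩ := hres a
  obtain ⟨hb, hb'⟩ := hres b
  have h := hT _ _ _ _ ha hb
  rw [ha', hb'] at h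
  set g := G a - G b with hg
  set f := F a - F b with hf
  obtain ⟨d, hd⟩ : ∃ d, d = a - b := ⟨_, rfl⟩
  rw [← hd]
  have e1 : G a - F a - (G b - F b) = g - f := by rw [hg, hf]; abel
  have e2 : a - lam • G a - (b - lam • G b) = d - lam • g := by rw [hg, hd, smul_sub]; abel
  rw [e1, e2, norm_sub_sq_real, inner_sub_left, inner_sub_right g, inner_sub_right f,
    real_inner_smul_right, real_inner_smul_right, real_inner_self_eq_norm_sq] at h
  have hfd : ‖f‖ ^ 2 ≤ L * ⟪f, d⟫ := by
    have := hF a b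
    rw [← hd, ← hf] at this
    rw [ge_iff_le, one_div, inv_mul_le_iff₀ hL] at this
    exact this
  have hsq : 0 ≤ ‖(2 * (1 - ρ * Lhat)) • f - ((lam - 2 * ρ) * Lhat) • g‖ ^ 2 := sq_nonneg _
  rw [norm_sub_sq_real, norm_smul, norm_smul, mul_pow, mul_pow, Real.norm_eq_abs, Real.norm_eq_abs,
    sq_abs, sq_abs, real_inner_smul_left, real_inner_smul_right] at hsq
  have hcomm : ⟪g, f⟫ = ⟪f, g⟫ := real_inner_comm _ _
  rw [hcomm] at h
  have hΛ : (Lhat - L) / (L * Lhat) * (L * ⟪f, d⟫) = ⟪f, d⟫ - L * ⟪f, d⟫ / Lhat := by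
    field_simp
  have h3 : ‖f‖ ^ 2 / Lhat ≤ L * ⟪f, d⟫ / Lhat := by gcongr
  have key : (lam * (4 - Lhat * lam) - 4 * ρ) / (4 * (1 - ρ * Lhat)) * ‖g‖ ^ 2
      ≤ (lam - ρ) * ‖g‖ ^ 2 - (lam - 2 * ρ) * ⟪f, g⟫ + (1 / Lhat - ρ) * ‖f‖ ^ 2 := by
    rw [← sub_nonneg]
    have : (lam - ρ) * ‖g‖ ^ 2 - (lam - 2 * ρ) * ⟪f, g⟫ + (1 / Lhat - ρ) * ‖f‖ ^ 2
      - (lam * (4 - Lhat * lam) - 4 * ρ) / (4 * (1 - ρ * Lhat)) * ‖g‖ ^ 2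
      = ((2 * (1 - ρ * Lhat)) ^ 2 * ‖f‖ ^ 2 -
        2 * (2 * (1 - ρ * Lhat) * ((lam - 2 * ρ) * Lhat * ⟪f, g⟫)) +
        ((lam - 2 * ρ) * Lhat) ^ 2 * ‖g‖ ^ 2) / (4 * (1 - ρ * Lhat) * Lhat) := by
      field_simp
      ring
    rw [this]
    exact div_nonneg (by linarith) (by positivity)
  have h4 : (1 / Lhat - ρ) * ‖f‖ ^ 2 = ‖f‖ ^ 2 / Lhat - ρ * ‖f‖ ^ 2 := by ring
  linarith

theorem norm_forwardBackward_sub_le {F J G : E → E} {T : E → Set E} {ρ lam : ℝ}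
    (hlam0 : 0 < lam) (hlam : 2 * ρ ≤ lam)
    (hT : ∀ a b u v, u ∈ T a → v ∈ T b → ⟪u - v, a - b⟫ ≥ -ρ * ‖u - v‖ ^ 2)
    (hJ : ∀ a, a - J a ∈ lam • T (J a))
    (hG : ∀ a, G a = (1 / lam) • (a - J (a - lam • F a))) (a f : E) :
    ‖(1 / lam) • (a - J (a - lam • f)) - G a‖ ≤ ‖f - F a‖ := by
  have h := norm_resolvent_sub_le hlam0 hlam hT hJ (a - lam • F a) (a - lam • f)
  have e1 : a - lam • F a - (a - lam • f) = lam • (f - F a) := by rw [smul_sub]; abel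
  rw [e1, norm_smul, Real.norm_of_nonneg hlam0.le] at h
  rw [hG, ← smul_sub, norm_smul, Real.norm_of_nonneg (by positivity), sub_sub_sub_cancel_left,
    one_div, inv_mul_le_iff₀ hlam0]
  exact h

/-- Lyapunov function of VFOSA₊: `g` is the operator value, `d = x - z`, `q = z - x⋆`, and `s` is
the parameter `t` of the previous iteration. -/
noncomputable def vfosaPotential {E : Type*} [NormedAddCommGroup E] [InnerProductSpace ℝ E]
    (β ν s : ℝ) (g d q : E) : ℝ :=
  s * ⟪g, d⟫ + β * (s * (s - 1)) * ‖g‖ ^ 2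
    + ν / (2 * (1 - ν) * β) * (s * (s - ν) / (s - 1) ^ 2) * ‖d‖ ^ 2
    + (s + ν) / (4 * ν * β * (s + 2 * ν - 1)) * ‖q‖ ^ 2

/-- The weighted Young inequality for inner products. -/
theorem neg_inner_le_of_sq_le {a b c : ℝ} (ha : 0 < a) (hc : c ^ 2 ≤ 4 * a * b) (v w : E) :
    -(c * ⟪v, w⟫) ≤ a * ‖v‖ ^ 2 + b * ‖w‖ ^ 2 := by
  have h : 0 ≤ ‖(2 * a) • v + c • w‖ ^ 2 := sq_nonneg _
  rw [norm_add_sq_real, norm_smul, norm_smul, mul_pow, mul_pow, Real.norm_eq_abs, Real.norm_eq_abs,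
    sq_abs, sq_abs, real_inner_smul_left, real_inner_smul_right] at h
  have h2 := mul_le_mul_of_nonneg_right hc (sq_nonneg ‖w‖)
  have h3 : 0 ≤ (4 * a) * (a * ‖v‖ ^ 2 + c * ⟪v, w⟫ + b * ‖w‖ ^ 2) := by nlinarith
  have := nonneg_of_mul_nonneg_right h3 (by positivity)
  linarith

theorem vfosaPotential_ge {β ν s bb : ℝ} (hβ : 0 < β) (hν : 0 < ν) (hν' : ν < 1 / 3)
    (hs : 1 < s) (hbb : β ≤ bb) {g d q : E} (h : bb * ‖g‖ ^ 2 ≤ ⟪g, q + d⟫) :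
    β / 2 * s ^ 2 * ‖g‖ ^ 2 ≤ vfosaPotential β ν s g d q := by
  have hy := neg_inner_le_of_sq_le (a := 1 / (2 * β)) (b := β / 2 * s ^ 2) (c := -s)
    (by positivity) (le_of_eq (by field_simp; norm_num)) q g
  rw [inner_add_right] at h
  have hqg : ⟪q, g⟫ = ⟪g, q⟫ := real_inner_comm _ _
  have h1 := mul_le_mul_of_nonneg_left h (by linarith : 0 ≤ s)
  have h2 : 1 / (2 * β) * ‖q‖ ^ 2 ≤ (s + ν) / (4 * ν * β * (s + 2 * ν - 1)) * ‖q‖ ^ 2 := by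
    gcongr ?_ * _
    rw [div_le_div_iff₀ (by positivity) (by apply mul_pos; positivity; linarith)]
    nlinarith [mul_pos hν hβ, mul_pos hβ (by linarith : 0 < s + ν), mul_pos hν (by linarith : 0 < s - 1)]
  have h3 : 0 ≤ ν / (2 * (1 - ν) * β) * (s * (s - ν) / (s - 1) ^ 2) * ‖d‖ ^ 2 := by
    have : 0 < 1 - ν := by linarith
    have : 0 < s - ν := by linarith
    have : 0 < s := by linarith
    positivity
  have h4 : s * (β * ‖g‖ ^ 2) ≤ s * (bb * ‖g‖ ^ 2) := by gcongr
  unfold vfosaPotential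
  rw [hqg] at hy
  linarith

section
variable {β ν t η bb : ℝ}

theorem inner_mono_descent (hβ : 0 < β) (hν : 0 < ν) (hν' : ν < 1 / 3) (ht : 1 < t)
    (hbb : β * (1 + ν) / (1 - ν) ≤ bb) {R : ℝ} {g g' gt D d d' : E}
    (hD : t • D = -d - (t * η) • gt) (hD' : (t - 1) • D = -d' - (2 * β * (t - 1)) • gt)
    (hmono : bb * ‖g' - g‖ ^ 2 + R ≤ ⟪g' - g, D⟫) :
    t * ⟪g', d'⟫ + β * (t * (t - 1)) * ‖g'‖ ^ 2 + t * (t - 1) * R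
      ≤ (t - 1) * ⟪g, d⟫ + (η - β) * (t * (t - 1)) * ‖g‖ ^ 2
        - (2 * β - η) * (t * (t - 1)) * ⟪g, gt - g⟫
        + β * (1 - ν) / (2 * ν) * (t * (t - 1)) * ‖gt - g‖ ^ 2 := by
  have hν1 : 0 < 1 - ν := by linarith
  set τ := t * (t - 1) with hτ
  have hτ0 : 0 < τ := mul_pos (by linarith) (by linarith)
  have h1 : τ * ⟪g', D⟫ = -(t * ⟪g', d'⟫) - 2 * β * τ * ⟪g', gt⟫ := by
    have := congrArg (fun v => t * ⟪g', v⟫) hD'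
    simp only [inner_sub_right, inner_neg_right, real_inner_smul_right] at this
    rw [hτ]; linarith
  have h2 : τ * ⟪g, D⟫ = -((t - 1) * ⟪g, d⟫) - η * τ * ⟪g, gt⟫ := by
    have := congrArg (fun v => (t - 1) * ⟪g, v⟫) hD
    simp only [inner_sub_right, inner_neg_right, real_inner_smul_right] at this
    rw [hτ]; linarith
  obtain ⟨e, rfl⟩ : ∃ e, gt = g + e := ⟨gt - g, by abel⟩
  obtain ⟨n, rfl⟩ : ∃ n, g' = g + n := ⟨g' - g, by abel⟩
  rw [add_sub_cancel_left] at *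
  have hy := neg_inner_le_of_sq_le (a := 2 * β * ν / (1 - ν)) (b := β * (1 - ν) / (2 * ν))
    (c := 2 * β) (by positivity) (le_of_eq (by field_simp; norm_num)) n e
  have hbb' : β + 2 * β * ν / (1 - ν) ≤ bb := by
    refine le_trans (le_of_eq ?_) hbb
    field_simp; ring
  have h3 := mul_le_mul_of_nonneg_right hbb' (sq_nonneg ‖n‖)
  have h4 := mul_le_mul_of_nonneg_left hmono hτ0.le
  have h5 : τ * ((β + 2 * β * ν / (1 - ν)) * ‖n‖ ^ 2 + -(2 * β * ⟪n, e⟫)) ≤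
    τ * (bb * ‖n‖ ^ 2 + (2 * β * ν / (1 - ν) * ‖n‖ ^ 2 + β * (1 - ν) / (2 * ν) * ‖e‖ ^ 2)) :=
    mul_le_mul_of_nonneg_left (by linarith) hτ0.le
  simp only [inner_add_left, inner_add_right, real_inner_self_eq_norm_sq] at h1 h2 ⊢
  rw [norm_add_sq_real]
  have hc : ⟪n, g⟫ = ⟪g, n⟫ := real_inner_comm _ _
  rw [hc] at h1
  nlinarith

theorem displacement_sq_descent (hβ : 0 < β) (hν : 0 < ν) (hν' : ν < 1 / 3) (ht : 1 + 4 * ν ≤ t)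
    (hη : η = 2 * β * (t - 1) / (t - ν)) {g gt d d' : E}
    (hd : d' = (1 - 1 / t) • d - ((1 - ν) * η) • gt) :
    ν / (2 * (1 - ν) * β) * (t * (t - ν) / (t - 1) ^ 2) * ‖d'‖ ^ 2
      ≤ ν / (2 * (1 - ν) * β) * ((t - 2 * ν) * (t - 2 * ν - ν) / (t - 2 * ν - 1) ^ 2) * ‖d‖ ^ 2
        - 2 * ν * ⟪d, g⟫ + 2 * ν * β * (t - 1) * ‖gt - g‖ ^ 2
        + 2 * ν * β * (1 - ν) * (t / (t - ν)) * ‖gt‖ ^ 2 := by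
  have h1ν : 0 < 1 - ν := by linarith
  have htν : 0 < t - ν := by linarith
  have ht1 : 0 < t - 1 := by linarith
  have ht0 : 0 < t := by linarith
  have h2t : 0 < 2 * t - 1 := by linarith
  have hs1 : 0 < t - 2 * ν - 1 := by linarith
  obtain ⟨e, rfl⟩ : ∃ e, gt = g + e := ⟨gt - g, by abel⟩
  rw [add_sub_cancel_left]
  set ε := ν / (2 * (1 - ν) * β) * (t * (t - ν) / (t - 1) ^ 2) with hε
  have hy := neg_inner_le_of_sq_le (a := ε * ((2 * t - 1) / t ^ 2)) (b := 2 * ν * β * (t - 1))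
    (c := 2 * ν) (by positivity) (by
      have : 4 * (ε * ((2 * t - 1) / t ^ 2)) * (2 * ν * β * (t - 1))
        = (2 * ν) ^ 2 * ((t - ν) * (2 * t - 1) / ((1 - ν) * (t - 1) * t)) := by
        rw [hε]; field_simp; ring
      rw [this]
      refine le_mul_of_one_le_right (by positivity) ?_
      rw [one_le_div (by positivity)]
      nlinarith [mul_pos ht0 hν, mul_pos ht1 hν, mul_pos (mul_pos ht0 hν) ht1]) d e
  have hmono : ν / (2 * (1 - ν) * β) * (t * (t - ν) / (t - 1) ^ 2) ≤
      ν / (2 * (1 - ν) * β) * ((t - 2 * ν) * (t - 2 * ν - ν) / (t - 2 * ν - 1) ^ 2) := by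
    refine mul_le_mul_of_nonneg_left ?_ (by positivity)
    have e1 : t * (t - ν) / (t - 1) ^ 2 = (1 + 1 / (t - 1)) * (1 + (1 - ν) / (t - 1)) := by
      field_simp; ring
    have e2 : (t - 2 * ν) * (t - 2 * ν - ν) / (t - 2 * ν - 1) ^ 2
        = (1 + 1 / (t - 2 * ν - 1)) * (1 + (1 - ν) / (t - 2 * ν - 1)) := by
      field_simp; ring
    rw [e1, e2]
    gcongr <;> linarith
  have h3 := mul_le_mul_of_nonneg_right hmono (sq_nonneg ‖d‖)
  have hexp : ε * ‖d'‖ ^ 2 = ε * (1 - 1 / t) ^ 2 * ‖d‖ ^ 2 - 2 * ν * ⟪d, g + e⟫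
      + 2 * ν * β * (1 - ν) * (t / (t - ν)) * ‖g + e‖ ^ 2 := by
    have c1 : ε * ((1 - 1 / t) * ((1 - ν) * η)) = ν := by
      rw [hε, hη]; field_simp
    have c2 : ε * ((1 - ν) * η) ^ 2 = 2 * ν * β * (1 - ν) * (t / (t - ν)) := by
      rw [hε, hη]; field_simp
    rw [hd, norm_sub_sq_real, norm_smul, norm_smul, mul_pow, mul_pow, Real.norm_eq_abs,
      Real.norm_eq_abs, sq_abs, sq_abs, real_inner_smul_left, real_inner_smul_right, ← c2]
    linear_combination (-2 * ⟪d, g + e⟫) * c1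
  have c3 : ε * (1 - 1 / t) ^ 2 = ε - ε * ((2 * t - 1) / t ^ 2) := by
    field_simp; ring
  rw [hexp, c3, inner_add_right]
  rw [← hε] at h3
  linarith

theorem distance_sq_descent (hβ : 0 < β) (hν : 0 < ν) (hν' : ν < 1 / 3) (ht : 1 + 4 * ν ≤ t)
    (hη : η = 2 * β * (t - 1) / (t - ν)) {g gt q q' : E}
    (hq : q' = q - (ν * η) • gt) :
    (t + ν) / (4 * ν * β * (t + 2 * ν - 1)) * ‖q'‖ ^ 2
      ≤ (t - 2 * ν + ν) / (4 * ν * β * (t - 2 * ν + 2 * ν - 1)) * ‖q‖ ^ 2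
        - ⟪g, q⟫ + ν * β * ((t - 1) / (t - ν)) * (‖g‖ ^ 2 - ‖gt - g‖ ^ 2)
        + β * ((t - 1) * (t - 1 + 2 * ν)) / (2 * (1 - ν)) * ‖gt - g‖ ^ 2 := by
  have h1ν : 0 < 1 - ν := by linarith
  have htν : 0 < t - ν := by linarith
  have ht1 : 0 < t - 1 := by linarith
  have ht2 : 0 < t - 1 + 2 * ν := by linarith
  obtain ⟨e, rfl⟩ : ∃ e, gt = g + e := ⟨gt - g, by abel⟩
  rw [add_sub_cancel_left]
  have r1 : t - 2 * ν + ν = t - ν := by ring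
  have r2 : t - 2 * ν + 2 * ν - 1 = t - 1 := by ring
  have r3 : t + 2 * ν - 1 = t - 1 + 2 * ν := by ring
  rw [r1, r2, r3]
  have hc : (t + ν) / (4 * ν * β * (t - 1 + 2 * ν)) = (t - ν) / (4 * ν * β * (t - 1))
      - (1 - ν) / (2 * β * ((t - 1) * (t - 1 + 2 * ν))) := by
    field_simp; ring
  have hy := neg_inner_le_of_sq_le (a := (1 - ν) / (2 * β * ((t - 1) * (t - 1 + 2 * ν))))
    (b := β * ((t - 1) * (t - 1 + 2 * ν)) / (2 * (1 - ν)))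
    (c := 1) (by positivity) (le_of_eq (by field_simp; norm_num)) q' e
  set c := (t - ν) / (4 * ν * β * (t - 1)) with hcdef
  have c1 : c * (ν * η) = 1 / 2 := by
    rw [hcdef, hη]; field_simp; norm_num
  have c2 : c * (ν * η) ^ 2 = ν * β * ((t - 1) / (t - ν)) := by
    rw [hcdef, hη]; field_simp; norm_num
  have c3 : ν * η = 2 * (ν * β * ((t - 1) / (t - ν))) := by rw [hη]; ring
  have hexp : c * ‖q'‖ ^ 2 = c * ‖q‖ ^ 2 - ⟪q, g + e⟫
      + ν * β * ((t - 1) / (t - ν)) * ‖g + e‖ ^ 2 := by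
    rw [hq, norm_sub_sq_real, norm_smul, mul_pow, Real.norm_eq_abs, sq_abs,
      real_inner_smul_right, ← c2]
    linear_combination (-2 * ⟪q, g + e⟫) * c1
  have hq' : ⟪q', e⟫ = ⟪q, e⟫ - 2 * (ν * β * ((t - 1) / (t - ν))) * (⟪g, e⟫ + ‖e‖ ^ 2) := by
    rw [hq, inner_sub_left, real_inner_smul_left, inner_add_left, real_inner_self_eq_norm_sq, c3]
  rw [hc, sub_mul, hexp]
  rw [one_mul, hq'] at hy
  have hgq : ⟪g, q⟫ = ⟪q, g⟫ := real_inner_comm _ _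
  rw [hgq, inner_add_right, norm_add_sq_real]
  linarith

/-- The remainder terms of the one-step estimates are absorbed by the potential. -/
theorem vfosa_coefficients_le (hβ : 0 < β) (hν : 0 < ν) (hν' : ν < 1 / 3) (ht : 1 + 4 * ν ≤ t)
    (hη : η = 2 * β * (t - 1) / (t - ν)) (hbb : β * (1 + ν) / (1 - ν) ≤ bb) (g gt : E) :
    (η - β) * (t * (t - 1)) * ‖g‖ ^ 2
        - (2 * β - η) * (t * (t - 1)) * ⟪g, gt - g⟫
        + β * (1 - ν) / (2 * ν) * (t * (t - 1)) * ‖gt - g‖ ^ 2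
        + 2 * ν * β * (t - 1) * ‖gt - g‖ ^ 2
        + 2 * ν * β * (1 - ν) * (t / (t - ν)) * ‖gt‖ ^ 2
        + ν * β * ((t - 1) / (t - ν)) * (‖g‖ ^ 2 - ‖gt - g‖ ^ 2)
        + β * ((t - 1) * (t - 1 + 2 * ν)) / (2 * (1 - ν)) * ‖gt - g‖ ^ 2
      ≤ β * ((t - 2 * ν) * (t - 2 * ν - 1)) * ‖g‖ ^ 2 + bb * ‖g‖ ^ 2
        + 5 * β / (4 * ν) * (t * (t - 1)) * ‖gt - g‖ ^ 2 := by
  have h1ν : 0 < 1 - ν := by linarith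
  have htν : 0 < t - ν := by linarith
  have ht1 : 0 < t - 1 := by linarith
  have ht0 : 0 < t := by linarith
  obtain ⟨e, rfl⟩ : ∃ e, gt = g + e := ⟨gt - g, by abel⟩
  rw [add_sub_cancel_left, norm_add_sq_real]
  set h := (1 - ν) * t * (t - 1 - 2 * ν) / (t - ν) with hh
  have hh0 : 0 ≤ h := by
    have : 0 ≤ t - 1 - 2 * ν := by linarith
    positivity
  have hh1 : h ≤ t - 1 := by
    rw [hh, div_le_iff₀ htν]
    nlinarith [mul_pos hν ht1, mul_pos hν ht0]
  have hy := neg_inner_le_of_sq_le (a := β * (1 - ν)) (b := β * ((t - 1) ^ 2 / (1 - ν)))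
    (c := 2 * β * h) (by positivity) (by
      have : 4 * (β * (1 - ν)) * (β * ((t - 1) ^ 2 / (1 - ν))) = 4 * β ^ 2 * (t - 1) ^ 2 := by
        field_simp
      rw [this, mul_pow, mul_pow]
      norm_num
      gcongr) g e
  have hA : (η - β) * (t * (t - 1)) + 2 * ν * β * (1 - ν) * (t / (t - ν))
      + ν * β * ((t - 1) / (t - ν)) + β * (1 - ν)
      ≤ β * ((t - 2 * ν) * (t - 2 * ν - 1)) + bb := by
    have h1 : (η - β) * (t * (t - 1)) ≤ β * ((t - 2 * ν) * (t - 2 * ν - 1)) := by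
      have e1 : (η - β) * (t * (t - 1)) = β * (((t - 2 + ν) * (t * (t - 1))) / (t - ν)) := by
        rw [hη]; field_simp; ring
      rw [e1]
      refine mul_le_mul_of_nonneg_left ?_ hβ.le
      rw [div_le_iff₀ htν]
      obtain ⟨w, rfl⟩ : ∃ w, t = 1 + 4 * ν + w := ⟨t - (1 + 4 * ν), by ring⟩
      have hw : 0 ≤ w := by linarith
      have k0 : 0 ≤ ν * (3 + 3 * ν - 34 * ν ^ 2) := by
        refine mul_nonneg hν.le ?_
        nlinarith
      have k1 : 0 ≤ (2 - 6 * ν) * w ^ 2 := mul_nonneg (by linarith) (sq_nonneg w)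
      have k2 : 0 ≤ w * (2 * (2 - 6 * ν) * (1 + 4 * ν) + 8 * ν ^ 2 + 4 * ν - 2) := by
        refine mul_nonneg hw ?_
        nlinarith
      linarith
    have h2 : (1 - ν) * (t / (t - ν)) ≤ 1 := by
      rw [← mul_div_assoc, div_le_one htν]
      nlinarith
    have h3 : (t - 1) / (t - ν) ≤ 1 := by
      rw [div_le_one htν]; linarith
    have h4 : β * (1 + 2 * ν) ≤ bb := by
      refine le_trans ?_ hbb
      rw [le_div_iff₀ h1ν]
      nlinarith [mul_pos hβ (mul_pos hν hν)]
    have h5 := mul_le_mul_of_nonneg_left h2 (by positivity : 0 ≤ 2 * ν * β)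
    have h6 := mul_le_mul_of_nonneg_left h3 (by positivity : 0 ≤ ν * β)
    linarith
  have hB : -((2 * β - η) * (t * (t - 1))) + 2 * (2 * ν * β * (1 - ν) * (t / (t - ν)))
      = -(2 * β * h) := by
    rw [hη, hh]; field_simp; ring
  have hC : β * (1 - ν) / (2 * ν) * (t * (t - 1)) + 2 * ν * β * (t - 1)
      + 2 * ν * β * (1 - ν) * (t / (t - ν)) - ν * β * ((t - 1) / (t - ν))
      + β * ((t - 1) * (t - 1 + 2 * ν)) / (2 * (1 - ν)) + β * ((t - 1) ^ 2 / (1 - ν))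
      ≤ 5 * β / (4 * ν) * (t * (t - 1)) := by
    have h2 : (1 - ν) * (t / (t - ν)) ≤ 1 := by
      rw [← mul_div_assoc, div_le_one htν]
      nlinarith
    have h3 : 0 ≤ (t - 1) / (t - ν) := by positivity
    have h4 : (t - 1) * (t - 1 + 2 * ν) / (2 * (1 - ν)) ≤ 3 / 4 * (t * (t - 1)) := by
      rw [div_le_iff₀ (by positivity)]
      have : (t - 1) * (t - 1 + 2 * ν) ≤ (t - 1) * t := by gcongr; linarith
      nlinarith [mul_pos ht0 ht1]
    have h5 : (t - 1) ^ 2 / (1 - ν) ≤ 3 / 2 * (t * (t - 1)) := by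
      rw [div_le_iff₀ (by positivity)]
      nlinarith [mul_pos ht0 ht1]
    have h6 : 9 / 4 * (t * (t - 1)) ≤ 3 / (4 * ν) * (t * (t - 1)) := by
      refine mul_le_mul_of_nonneg_right ?_ (by positivity)
      rw [le_div_iff₀ (by positivity)]
      linarith
    have h7 : 2 * ν * t ≤ 1 / 2 * (t * (t - 1)) := by nlinarith
    have h8 := mul_le_mul_of_nonneg_left h2 (by positivity : 0 ≤ 2 * ν)
    have h9 := mul_nonneg hν.le h3
    have e1 : 5 * β / (4 * ν) * (t * (t - 1)) = β * (3 / (4 * ν) * (t * (t - 1))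
      + 1 / 2 * (t * (t - 1))) + β * (1 - ν) / (2 * ν) * (t * (t - 1)) := by
      field_simp; ring
    rw [e1]
    have := mul_le_mul_of_nonneg_left (by linarith : 2 * ν * (t - 1)
      + 2 * ν * ((1 - ν) * (t / (t - ν))) - ν * ((t - 1) / (t - ν))
      + (t - 1) * (t - 1 + 2 * ν) / (2 * (1 - ν)) + (t - 1) ^ 2 / (1 - ν) ≤
      3 / (4 * ν) * (t * (t - 1)) + 1 / 2 * (t * (t - 1))) hβ.le
    have e2 : β * ((t - 1) * (t - 1 + 2 * ν)) / (2 * (1 - ν))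
      = β * ((t - 1) * (t - 1 + 2 * ν) / (2 * (1 - ν))) := by ring
    rw [e2]
    linarith
  have hA' := mul_le_mul_of_nonneg_right hA (sq_nonneg ‖g‖)
  have hC' := mul_le_mul_of_nonneg_right hC (sq_nonneg ‖e‖)
  have hB' := congrArg (· * ⟪g, e⟫) hB
  linarith

/-- One-step decrease of the potential, up to the squared estimation error. -/
theorem vfosaPotential_step (hβ : 0 < β) (hν : 0 < ν) (hν' : ν < 1 / 3) (ht : 1 + 4 * ν ≤ t)
    (hη : η = 2 * β * (t - 1) / (t - ν)) (hbb : β * (1 + ν) / (1 - ν) ≤ bb) {R : ℝ}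
    {g g' gt x x' z z' xs y : E} (hy : y = (1 / t) • ((t - 1) • x + z)) (hx : x' = y - η • gt)
    (hz : z' = z + ν • (x' - y)) (hmono : bb * ‖g' - g‖ ^ 2 + R ≤ ⟪g' - g, x' - x⟫)
    (hstar : bb * ‖g‖ ^ 2 ≤ ⟪g, x - xs⟫) :
    vfosaPotential β ν t g' (x' - z') (z' - xs) + t * (t - 1) * R
      ≤ vfosaPotential β ν (t - 2 * ν) g (x - z) (z - xs)
        + 5 * β / (4 * ν) * (t * (t - 1)) * ‖gt - g‖ ^ 2 := by
  have ht0 : t ≠ 0 := by linarith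
  have htν : t - ν ≠ 0 := by linarith
  have hz' : z' = z - (ν * η) • gt := by
    rw [hz, hx, sub_sub_cancel_left, smul_neg, smul_smul, sub_eq_add_neg]
  have hx' : x' - x = -(1 / t) • (x - z) - η • gt := by
    rw [hx, hy]
    match_scalars <;> field_simp <;> ring
  have hd : x' - z' = (1 - 1 / t) • (x - z) - ((1 - ν) * η) • gt := by
    rw [hz', hx, hy]
    match_scalars <;> field_simp <;> ring
  have hD : t • (x' - x) = -(x - z) - (t * η) • gt := by
    rw [hx']
    match_scalars <;> field_simp
  have hD' : (t - 1) • (x' - x) = -(x' - z') - (2 * β * (t - 1)) • gt := by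
    rw [hx', hd, hη]
    match_scalars <;> field_simp <;> ring
  have hq : z' - xs = (z - xs) - (ν * η) • gt := by rw [hz']; abel
  have A := inner_mono_descent hβ hν hν' (by linarith) hbb hD hD' hmono
  have B := displacement_sq_descent (g := g) hβ hν hν' ht hη hd
  have C := distance_sq_descent (g := g) hβ hν hν' ht hη hq
  have D := vfosa_coefficients_le hβ hν hν' ht hη hbb g gt
  have e1 : ⟪g, x - xs⟫ = ⟪g, x - z⟫ + ⟪g, z - xs⟫ := by
    rw [← inner_add_right, sub_add_sub_cancel]
  have e2 : ⟪x - z, g⟫ = ⟪g, x - z⟫ := real_inner_comm _ _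
  rw [e1] at hstar
  rw [e2] at B
  unfold vfosaPotential
  linarith

end

theorem le_add_sum_of_variance_recursion {P D Eb τ κ Θ σ Γ : ℕ → ℝ} {c Λ : ℝ}
    (hτ : ∀ k, 0 ≤ τ k) (hD : ∀ k, 0 ≤ D k) (hEb : ∀ k, 0 ≤ Eb k) (hΓ : ∀ k, 0 < Γ k)
    (hΘ : ∀ k, 0 < Θ k) (hκ : ∀ k, κ k ≤ 1) (hΓΘ : ∀ k, Γ k * Θ k ≤ 2 * Λ)
    (hstep : ∀ k, P (k + 1) + Λ * τ (k + 1) * Eb (k + 1) ≤ P k + c / 2 * τ (k + 1) * D k)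
    (hD0 : D 0 ≤ σ 0 ^ 2)
    (hDs : ∀ k, D (k + 1) ≤ (1 - κ (k + 1)) * D k + Θ (k + 1) * Eb (k + 1) + σ (k + 1) ^ 2)
    (hcond : ∀ k, Γ (k + 1) * τ (k + 1) * (1 - κ (k + 1)) + c * τ (k + 1) ≤ Γ k * τ k) (K : ℕ) :
    P K ≤ P 0 + Λ * ∑ k ∈ Finset.range K, τ k * σ k ^ 2 / Θ k := by
  have hσ : ∀ k, 1 / 2 * Γ k * τ k * σ k ^ 2 ≤ Λ * (τ k * σ k ^ 2 / Θ k) := by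
    intro k
    rw [← mul_div_assoc, le_div_iff₀ (hΘ k)]
    have := mul_le_mul_of_nonneg_right (hΓΘ k) (mul_nonneg (hτ k) (sq_nonneg (σ k)))
    linarith
  have hW : ∀ k, P k + 1 / 2 * Γ k * τ k * D k
      ≤ P 0 + Λ * ∑ j ∈ Finset.range (k + 1), τ j * σ j ^ 2 / Θ j := by
    intro k
    induction k with
    | zero =>
      have h1 := mul_le_mul_of_nonneg_left hD0
        (mul_nonneg (mul_nonneg (by norm_num : (0 : ℝ) ≤ 1 / 2) (hΓ 0).le) (hτ 0))
      have h2 := hσ 0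
      rw [Finset.sum_range_one]
      linarith
    | succ k ih =>
      have h1 := mul_le_mul_of_nonneg_left (hDs k)
        (mul_nonneg (mul_nonneg (by norm_num : (0 : ℝ) ≤ 1 / 2) (hΓ (k + 1)).le) (hτ (k + 1)))
      have h2 := hσ (k + 1)
      have h3 := mul_le_mul_of_nonneg_right (hcond k) (hD k)
      have h4 := mul_le_mul_of_nonneg_right (hΓΘ (k + 1))
        (mul_nonneg (hτ (k + 1)) (hEb (k + 1)))
      have h5 := hstep k
      rw [Finset.sum_range_succ, mul_add]
      linarith
  cases K with
  | zero => simp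
  | succ k =>
    have h1 := hW k
    have h2 := hstep k
    have h3 := mul_le_mul_of_nonneg_right (hcond k) (hD k)
    have h4 := mul_nonneg (mul_nonneg (mul_nonneg (hΓ (k + 1)).le (hτ (k + 1)))
      (sub_nonneg.2 (hκ (k + 1)))) (hD k)
    have hΛ : 0 ≤ Λ := by
      have := mul_pos (hΓ 0) (hΘ 0)
      linarith [hΓΘ 0]
    have h5 := mul_nonneg (mul_nonneg hΛ (hτ (k + 1))) (hEb (k + 1))
    linarith

theorem MeasureTheory.MemLp.integrable_real_inner {Ω : Type*} {m0 : MeasurableSpace Ω}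
    {P : Measure Ω} {f g : Ω → E} (hf : MemLp f 2 P) (hg : MemLp g 2 P) :
    Integrable (fun ω => ⟪f ω, g ω⟫) P := by
  refine (((hf.add hg).integrable_norm_pow two_ne_zero).sub
    ((hf.integrable_norm_pow two_ne_zero).add (hg.integrable_norm_pow two_ne_zero))
    |>.div_const 2).congr (ae_of_all _ fun ω => ?_)
  simp only [Pi.add_apply, Pi.sub_apply, norm_add_sq_real]
  ring

theorem integrable_vfosaPotential {Ω : Type*} {m0 : MeasurableSpace Ω} {P : Measure Ω}
    (β ν s : ℝ) {g d q : Ω → E} (hg : MemLp g 2 P) (hd : MemLp d 2 P) (hq : MemLp q 2 P) :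
    Integrable (fun ω => vfosaPotential β ν s (g ω) (d ω) (q ω)) P := by
  unfold vfosaPotential
  exact ((((hg.integrable_real_inner hd).const_mul _).add
    ((hg.integrable_norm_pow two_ne_zero).const_mul _)).add
    ((hd.integrable_norm_pow two_ne_zero).const_mul _)).add
    ((hq.integrable_norm_pow two_ne_zero).const_mul _)

end

/-- Main `O(1/k²)` convergence rate of VFOSA₊ in expectation. -/
theorem stmt_12 (p : ℕ) (hp : 1 ≤ p)
    (L ρ Lhat lam μ r β : ℝ)
    (hL : 0 < L) (hρ : 0 ≤ ρ) (hLρ : L * ρ < 1)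
    (hLhat : L < Lhat) (hLhatρ : Lhat * ρ < 1)
    (hlam1 : 2 * ρ ≤ lam) (hlam2 : lam < 2 * (1 + Real.sqrt (1 - Lhat * ρ)) / Lhat)
    (hμ0 : 0 < μ) (hμ1 : μ < 2 / 3) (hr : r ≥ 2 + 1 / μ) (hβ0 : 0 < β)
    (F : EuclideanSpace ℝ (Fin p) → EuclideanSpace ℝ (Fin p))
    (hF : ∀ a b, ⟪F a - F b, a - b⟫ ≥ (1 / L) * ‖F a - F b‖ ^ 2)
    (T : EuclideanSpace ℝ (Fin p) → Set (EuclideanSpace ℝ (Fin p)))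
    (hT : ∀ a b u v, u ∈ T a → v ∈ T b → ⟪u - v, a - b⟫ ≥ -ρ * ‖u - v‖ ^ 2)
    (J : EuclideanSpace ℝ (Fin p) → EuclideanSpace ℝ (Fin p))
    (hJ : ∀ a, a - J a ∈ lam • T (J a))
    (G : EuclideanSpace ℝ (Fin p) → EuclideanSpace ℝ (Fin p))
    (hG : ∀ a, G a = (1 / lam) • (a - J (a - lam • F a)))
    (xstar : EuclideanSpace ℝ (Fin p)) (hxstar : G xstar = 0)
    (βbar Λ : ℝ)
    (hβbar : βbar = (lam * (4 - Lhat * lam) - 4 * ρ) / (4 * (1 - ρ * Lhat)))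
    (hΛ : Λ = (Lhat - L) / (L * Lhat))
    (hβub : β ≤ (2 - μ) * βbar / (2 + μ))
    {Ω : Type*} {m0 : MeasurableSpace Ω} (ℙ : Measure Ω) [IsProbabilityMeasure ℙ]
    (ℱ : Filtration ℕ m0)
    (x z y Gt Ft : ℕ → Ω → EuclideanSpace ℝ (Fin p))
    (hxmeas : ∀ k, StronglyMeasurable[ℱ k] (x k))
    (hzmeas : ∀ k, StronglyMeasurable[ℱ k] (z k))
    (hFtmeas : ∀ k, StronglyMeasurable[ℱ (k + 1)] (Ft k))
    (x0 : EuclideanSpace ℝ (Fin p)) (hx0 : ∀ ω, x 0 ω = x0) (hz0 : ∀ ω, z 0 ω = x0)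
    (hiter : ∀ᵐ ω ∂ℙ, ∀ k : ℕ,
      y k ω = (1 / (μ * ((k : ℝ) + r))) • ((μ * ((k : ℝ) + r) - 1) • x k ω + z k ω) ∧
      Gt k ω = (1 / lam) • (x k ω - J (x k ω - lam • Ft k ω)) ∧
      x (k + 1) ω = y k ω
        - (2 * β * (μ * ((k : ℝ) + r) - 1) / (μ * ((k : ℝ) + r) - μ / 2)) • Gt k ω ∧
      z (k + 1) ω = z k ω + (μ / 2) • (x (k + 1) ω - y k ω))
    (Δ Ebar : ℕ → Ω → ℝ) (κ Θ σ' : ℕ → ℝ)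
    (hΔmeas : ∀ k, StronglyMeasurable[ℱ (k + 1)] (Δ k))
    (hΔpos : ∀ k, ∀ᵐ ω ∂ℙ, 0 ≤ Δ k ω)
    (hEbarmeas : ∀ k, StronglyMeasurable[ℱ k] (Ebar k))
    (hEbarpos : ∀ k, ∀ᵐ ω ∂ℙ, 0 ≤ Ebar k ω)
    (hEbar0 : ∀ ω, Ebar 0 ω = 0)
    (hκ : ∀ k, 0 < κ k ∧ κ k ≤ 1) (hΘ : ∀ k, 0 < Θ k) (hσ : ∀ k, 0 ≤ σ' k)
    (hVR1 : ∀ k, ℙ[(fun ω => ‖Ft k ω - F (x k ω)‖ ^ 2)|ℱ k] ≤ᵐ[ℙ] ℙ[Δ k|ℱ k])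
    (hVR2 : ∀ k, ℙ[Δ k|ℱ k] ≤ᵐ[ℙ]
      fun ω => (1 - κ k) * (if k = 0 then 0 else Δ (k - 1) ω) + Θ k * Ebar k ω + σ' k ^ 2)
    (hEbarle : ∀ k, ∀ᵐ ω ∂ℙ,
      Ebar k ω ≤ L * ⟪F (x k ω) - F (x (k - 1) ω), x k ω - x (k - 1) ω⟫)
    (hint1 : ∀ k, Integrable (fun ω => ‖G (x k ω)‖ ^ 2) ℙ)
    (hint2 : ∀ k, Integrable (fun ω => ‖Ft k ω - F (x k ω)‖ ^ 2) ℙ)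
    (hint3 : ∀ k, Integrable (Δ k) ℙ)
    (hint4 : ∀ k, Integrable (Ebar k) ℙ)
    (hint5 : ∀ k, Integrable (fun ω => ‖z k ω - xstar‖ ^ 2) ℙ)
    (Γ : ℕ → ℝ) (hΓ : ∀ k, 0 < Γ k)
    (hΓcond : ∀ k : ℕ, 1 ≤ k →
      κ k ≥ 1 - Γ (k - 1) * (μ * ((k : ℝ) + r - 2)) * (μ * ((k : ℝ) + r - 2) - 1)
          / (Γ k * (μ * ((k : ℝ) + r - 1)) * (μ * ((k : ℝ) + r - 1) - 1))
        + 5 * β / (μ * Γ k))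
    (hΓΘ : ∀ k, Γ k * Θ k ≤ 2 * Λ)
 :
    ∀ K : ℕ, ∫ ω, ‖G (x K ω)‖ ^ 2 ∂ℙ
      ≤ 2 * ((μ ^ 2 * r ^ 2 * ‖G x0‖ ^ 2 + (2 * r - 1) / (4 * β ^ 2 * (μ * r - 1)) * ‖x0 - xstar‖ ^ 2) + (μ * r ^ 2 * (Γ 0 * μ + β) / (2 * β) * σ' 0 ^ 2) + ((Λ / β) * ∑ k ∈ Finset.range K, (μ * ((k : ℝ) + r - 1)) * (μ * ((k : ℝ) + r - 1) - 1) * σ' k ^ 2 / Θ k))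
        / (μ ^ 2 * ((K : ℝ) + r - 1) ^ 2) := by
  have hLh : 0 < Lhat := hL.trans hLhat
  have hD0 : 0 < 1 - ρ * Lhat := by linarith
  have hβbar0 : 0 < βbar := by
    have h1 : 0 < (2 - μ) * βbar / (2 + μ) := hβ0.trans_le hβub
    rw [div_pos_iff_of_pos_right (by linarith)] at h1
    exact pos_of_mul_pos_right h1 (by linarith)
  have hlam0 : 0 < lam := by
    refine lt_of_le_of_ne (by linarith) ?_
    rintro rfl
    rw [hβbar, div_pos_iff_of_pos_right (by linarith)] at hβbar0
    linarith
  have hΛ0 : 0 ≤ Λ := by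
    rw [hΛ]
    exact div_nonneg (by linarith) (by positivity)
  have hmono : ∀ a b, βbar * ‖G a - G b‖ ^ 2 + Λ * (L * ⟪F a - F b, a - b⟫)
      ≤ ⟪G a - G b, a - b⟫ := by
    intro a b
    rw [hβbar, hΛ]
    exact forwardBackward_inner_ge hL hLhat hLhatρ hlam0 hF hT hJ hG a b
  have hFnn : ∀ a b, 0 ≤ L * ⟪F a - F b, a - b⟫ := fun a b =>
    mul_nonneg hL.le (le_trans (by positivity) (hF a b))
  have hGlip : LipschitzWith (Real.toNNReal (1 / βbar)) G := by
    refine LipschitzWith.of_dist_le_mul fun a b => ?_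
    rw [Real.coe_toNNReal _ (by positivity), dist_eq_norm, dist_eq_norm, one_div,
      le_inv_mul_iff₀ hβbar0]
    have h1 := hmono a b
    have h2 := real_inner_le_norm (G a - G b) (a - b)
    have h3 := mul_nonneg hΛ0 (hFnn a b)
    rcases (norm_nonneg (G a - G b)).eq_or_lt with h | h
    · rw [← h, mul_zero]; exact norm_nonneg _
    · refine le_of_mul_le_mul_left ?_ h
      nlinarith
  set ν := μ / 2 with hν
  have hμν : μ = 2 * ν := by rw [hν]; ring
  have hν0 : 0 < ν := by positivity
  have hν1 : ν < 1 / 3 := by linarith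
  have hμr : 2 * μ + 1 ≤ μ * r := by
    have := mul_le_mul_of_nonneg_left hr hμ0.le
    rw [mul_add, mul_one_div_cancel hμ0.ne'] at this
    linarith
  have hbb : β * (1 + ν) / (1 - ν) ≤ βbar := by
    rw [le_div_iff₀ (by linarith)] at hβub
    rw [div_le_iff₀ (by linarith)]
    rw [hμν] at hβub
    linarith
  have hβbb : β ≤ βbar := by
    refine le_trans ?_ hbb
    rw [le_div_iff₀ (by linarith)]
    nlinarith
  obtain ⟨s, hs⟩ : ∃ s : ℕ → ℝ, ∀ k, s k = μ * ((k : ℝ) + r - 1) := ⟨_, fun _ => rfl⟩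
  have hs1 : ∀ k, 1 + 2 * ν ≤ s k := by
    intro k
    rw [hs]
    have : 0 ≤ μ * (k : ℝ) := by positivity
    linarith
  have hst : ∀ k : ℕ, μ * ((k : ℝ) + r) = s (k + 1) := by
    intro k; rw [hs]; push_cast; ring
  have hss : ∀ k, s (k + 1) - 2 * ν = s k := by
    intro k; rw [hs, hs]; push_cast; linarith
  obtain ⟨η, hη⟩ : ∃ η : ℕ → ℝ, ∀ k, η k = 2 * β * (s (k + 1) - 1) / (s (k + 1) - ν) :=
    ⟨_, fun _ => rfl⟩
  have hη0 : ∀ k, 0 < η k := by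
    intro k
    have := hs1 (k + 1)
    rw [hη]
    exact div_pos (mul_pos (by positivity) (by linarith)) (by linarith)
  simp only [hst, ← hη] at hiter
  have hxm : ∀ k, AEStronglyMeasurable (x k) ℙ := fun k =>
    ((hxmeas k).mono (ℱ.le k)).aestronglyMeasurable
  have hzm : ∀ k, AEStronglyMeasurable (z k) ℙ := fun k =>
    ((hzmeas k).mono (ℱ.le k)).aestronglyMeasurable
  have hzL : ∀ k, MemLp (fun ω => z k ω - xstar) 2 ℙ := fun k =>
    (memLp_two_iff_integrable_sq_norm ((hzm k).sub aestronglyMeasurable_const)).2 (hint5 k)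
  have hgL : ∀ k, MemLp (fun ω => G (x k ω)) 2 ℙ := fun k =>
    (memLp_two_iff_integrable_sq_norm
      (hGlip.continuous.comp_aestronglyMeasurable (hxm k))).2 (hint1 k)
  have hz' : ∀ᵐ ω ∂ℙ, ∀ k, z (k + 1) ω = z k ω - (ν * η k) • Gt k ω := by
    filter_upwards [hiter] with ω h k
    obtain ⟨h1, h2, h3, h4⟩ := h k
    rw [h4, h3, sub_sub_cancel_left, smul_neg, smul_smul, sub_eq_add_neg]
  have hGtL : ∀ k, MemLp (Gt k) 2 ℙ := by
    intro k
    refine (((hzL k).sub (hzL (k + 1))).const_smul (1 / (ν * η k))).ae_eq ?_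
    filter_upwards [hz'] with ω h
    have := (mul_pos hν0 (hη0 k)).ne'
    simp only [Pi.smul_apply, Pi.sub_apply, h k]
    rw [sub_sub_sub_cancel_right, sub_sub_cancel, smul_smul, one_div_mul_cancel this, one_smul]
  have hdL : ∀ k, MemLp (fun ω => x k ω - z k ω) 2 ℙ := by
    intro k
    induction k with
    | zero =>
      simp only [hx0, hz0, sub_self]
      exact MemLp.zero
    | succ k ih =>
      refine ((ih.const_smul (1 - 1 / s (k + 1))).sub
        ((hGtL k).const_smul ((1 - ν) * η k))).ae_eq ?_
      filter_upwards [hiter, hz'] with ω h hz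
      obtain ⟨h1, h2, h3, h4⟩ := h k
      have := hs1 (k + 1)
      have hne : s (k + 1) ≠ 0 := by linarith
      simp only [Pi.smul_apply, Pi.sub_apply]
      rw [hz k, h3, h1]
      match_scalars <;> field_simp <;> ring
  obtain ⟨V, hV⟩ : ∃ V : ℕ → Ω → ℝ, ∀ k ω,
      V k ω = vfosaPotential β ν (s k) (G (x k ω)) (x k ω - z k ω) (z k ω - xstar) :=
    ⟨_, fun _ _ => rfl⟩
  have hVint : ∀ k, Integrable (V k) ℙ := by
    intro k
    rw [show V k = _ from funext (hV k)]
    exact integrable_vfosaPotential β ν (s k) (hgL k) (hdL k) (hzL k)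
  have hstar : ∀ a, βbar * ‖G a‖ ^ 2 ≤ ⟪G a, a - xstar⟫ := by
    intro a
    have h1 := hmono a xstar
    have h3 := mul_nonneg hΛ0 (hFnn a xstar)
    rw [hxstar, sub_zero] at h1
    linarith
  have hτ0 : ∀ k, 0 ≤ s k * (s k - 1) := fun k => by
    have := hs1 k
    exact mul_nonneg (by linarith) (by linarith)
  have hstep_ae : ∀ k, ∀ᵐ ω ∂ℙ,
      V (k + 1) ω + Λ * (s (k + 1) * (s (k + 1) - 1)) * Ebar (k + 1) ω
      ≤ V k ω + 5 * β / μ / 2 * (s (k + 1) * (s (k + 1) - 1)) * ‖Ft k ω - F (x k ω)‖ ^ 2 := by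
    intro k
    filter_upwards [hiter, hEbarle (k + 1)] with ω h hE
    obtain ⟨h1, h2, h3, h4⟩ := h k
    rw [Nat.add_sub_cancel] at hE
    have hm : βbar * ‖G (x (k + 1) ω) - G (x k ω)‖ ^ 2 + Λ * Ebar (k + 1) ω
        ≤ ⟪G (x (k + 1) ω) - G (x k ω), x (k + 1) ω - x k ω⟫ := by
      have h5 := hmono (x (k + 1) ω) (x k ω)
      have h6 := mul_le_mul_of_nonneg_left hE hΛ0
      linarith
    have ht : 1 + 4 * ν ≤ s (k + 1) := by linarith [hs1 k, hss k]
    have h7 := vfosaPotential_step hβ0 hν0 hν1 ht (hη k) hbb h1 h3 h4 hm (hstar (x k ω))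
    rw [hss k, ← hV, ← hV] at h7
    have h8 : ‖Gt k ω - G (x k ω)‖ ≤ ‖Ft k ω - F (x k ω)‖ := by
      rw [h2]
      exact norm_forwardBackward_sub_le hlam0 hlam1 hT hJ hG _ _
    have h9 : 5 * β / (4 * ν) * (s (k + 1) * (s (k + 1) - 1)) * ‖Gt k ω - G (x k ω)‖ ^ 2
        ≤ 5 * β / (4 * ν) * (s (k + 1) * (s (k + 1) - 1)) * ‖Ft k ω - F (x k ω)‖ ^ 2 := by
      have := hτ0 (k + 1)
      gcongr
    have e1 : 5 * β / μ / 2 = 5 * β / (4 * ν) := by rw [hμν, div_div]; ring_nf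
    rw [e1]
    linarith
  have hFtΔ : ∀ k, ∫ ω, ‖Ft k ω - F (x k ω)‖ ^ 2 ∂ℙ ≤ ∫ ω, Δ k ω ∂ℙ := by
    intro k
    rw [← integral_condExp (ℱ.le k), ← integral_condExp (f := Δ k) (ℱ.le k)]
    exact integral_mono_ae integrable_condExp integrable_condExp (hVR1 k)
  intro K
  have hmain := le_add_sum_of_variance_recursion (P := fun k => ∫ ω, V k ω ∂ℙ)
    (D := fun k => ∫ ω, Δ k ω ∂ℙ) (Eb := fun k => ∫ ω, Ebar k ω ∂ℙ)
    (τ := fun k => s k * (s k - 1)) (κ := κ) (Θ := Θ) (σ := σ') (Γ := Γ) (c := 5 * β / μ) (Λ := Λ)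
    hτ0 (fun k => integral_nonneg_of_ae (hΔpos k)) (fun k => integral_nonneg_of_ae (hEbarpos k))
    hΓ hΘ (fun k => (hκ k).2) hΓΘ
    (by
      intro k
      have h1 := integral_mono_ae ((hVint (k + 1)).add ((hint4 (k + 1)).const_mul _))
        ((hVint k).add ((hint2 k).const_mul _)) (hstep_ae k)
      simp only [Pi.add_apply] at h1
      rw [integral_add (hVint _) ((hint4 _).const_mul _),
        integral_add (hVint _) ((hint2 _).const_mul _), integral_const_mul,
        integral_const_mul] at h1
      have h2 := mul_le_mul_of_nonneg_left (hFtΔ k)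
        (mul_nonneg (by positivity : 0 ≤ 5 * β / μ / 2) (hτ0 (k + 1)))
      linarith)
    (by
      have h1 := hVR2 0
      simp only [if_true, hEbar0, mul_zero, zero_add] at h1
      have h2 := integral_mono_ae integrable_condExp (integrable_const _) h1
      rw [integral_condExp (ℱ.le 0), integral_const, probReal_univ, one_smul] at h2
      exact h2)
    (by
      intro k
      have h1 := hVR2 (k + 1)
      simp only [Nat.add_eq_zero_iff, one_ne_zero, and_false, if_false,
        Nat.add_sub_cancel] at h1
      have i1 : Integrable (fun ω => (1 - κ (k + 1)) * Δ k ω) ℙ := (hint3 k).const_mul _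
      have i2 : Integrable (fun ω => Θ (k + 1) * Ebar (k + 1) ω) ℙ := (hint4 (k + 1)).const_mul _
      have i12 : Integrable (fun ω => (1 - κ (k + 1)) * Δ k ω + Θ (k + 1) * Ebar (k + 1) ω) ℙ :=
        i1.add i2
      have h2 := integral_mono_ae integrable_condExp (i12.add (integrable_const _)) h1
      simp only [Pi.add_apply] at h2
      rw [integral_condExp (ℱ.le (k + 1)), integral_add i12 (integrable_const _),
        integral_add i1 i2, integral_const_mul, integral_const_mul, integral_const,
        probReal_univ, one_smul] at h2
      exact h2)
    (by
      intro k
      have h1 := hΓcond (k + 1) (Nat.le_add_left 1 k)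
      have e1 : μ * (((k + 1 : ℕ) : ℝ) + r - 2) = s k := by rw [hs]; push_cast; ring
      rw [e1, ← hs, Nat.add_sub_cancel] at h1
      have hp : 0 < Γ (k + 1) * (s (k + 1) * (s (k + 1) - 1)) := by
        have := hs1 (k + 1)
        exact mul_pos (hΓ _) (mul_pos (by linarith) (by linarith))
      have h2 := mul_le_mul_of_nonneg_left h1 hp.le
      have hs0 : s (k + 1) ≠ 0 := by linarith [hs1 (k + 1)]
      have hs0' : s (k + 1) - 1 ≠ 0 := by linarith [hs1 (k + 1)]
      have e2 : Γ (k + 1) * (s (k + 1) * (s (k + 1) - 1)) *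
          (1 - Γ k * s k * (s k - 1) / (Γ (k + 1) * s (k + 1) * (s (k + 1) - 1))
            + 5 * β / (μ * Γ (k + 1)))
          = Γ (k + 1) * (s (k + 1) * (s (k + 1) - 1)) - Γ k * (s k * (s k - 1))
            + 5 * β / μ * (s (k + 1) * (s (k + 1) - 1)) := by
        have := (hΓ (k + 1)).ne'
        field_simp
      rw [e2] at h2
      linarith)
    K
  have hlow : β / 2 * s K ^ 2 * ∫ ω, ‖G (x K ω)‖ ^ 2 ∂ℙ ≤ ∫ ω, V K ω ∂ℙ := by
    rw [← integral_const_mul]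
    refine integral_mono ((hint1 K).const_mul _) (hVint K) fun ω => ?_
    simp only [hV]
    refine vfosaPotential_ge hβ0 hν0 hν1 (by linarith [hs1 K]) hβbb ?_
    rw [sub_add_sub_cancel']
    exact hstar _
  have hV0 : ∫ ω, V 0 ω ∂ℙ ≤ β * (μ ^ 2 * r ^ 2 * ‖G x0‖ ^ 2
      + (2 * r - 1) / (4 * β ^ 2 * (μ * r - 1)) * ‖x0 - xstar‖ ^ 2) := by
    simp only [hV, hx0, hz0, integral_const, probReal_univ, one_smul, vfosaPotential, sub_self,
      inner_zero_right, norm_zero]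
    have hs0 : s 0 = μ * r - 2 * ν := by rw [hs, ← hμν]; push_cast; ring
    have hr1 : μ * r - 1 ≠ 0 := by linarith
    have e1 : (s 0 + ν) / (4 * ν * β * (s 0 + 2 * ν - 1))
        = β * ((2 * r - 1) / (4 * β ^ 2 * (μ * r - 1))) := by
      rw [hs0, sub_add_cancel, hν]
      field_simp
      ring
    have e2 : β * (s 0 * (s 0 - 1)) * ‖G x0‖ ^ 2 ≤ β * (μ ^ 2 * r ^ 2) * ‖G x0‖ ^ 2 := by
      have h0 := hs1 0
      rw [← mul_pow]
      gcongr
      rw [sq]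
      gcongr <;> linarith
    rw [e1]
    linarith
  have hE0 : 0 ≤ μ * r ^ 2 * (Γ 0 * μ + β) / (2 * β) * σ' 0 ^ 2 := by
    have := hΓ 0
    positivity
  have hsum : ∑ k ∈ Finset.range K, s k * (s k - 1) * σ' k ^ 2 / Θ k
      = ∑ k ∈ Finset.range K,
        (μ * ((k : ℝ) + r - 1)) * (μ * ((k : ℝ) + r - 1) - 1) * σ' k ^ 2 / Θ k := by
    simp only [hs]
  have hsK : 0 < s K := by linarith [hs1 K]
  have e4 : μ ^ 2 * ((K : ℝ) + r - 1) ^ 2 = s K ^ 2 := by rw [hs]; ring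
  rw [e4, le_div_iff₀ (by positivity), ← hsum]
  set S := ∑ k ∈ Finset.range K, s k * (s k - 1) * σ' k ^ 2 / Θ k
  have e3 : Λ * S = β * (Λ / β * S) := by field_simp
  rw [e3] at hmain
  refine le_of_mul_le_mul_left ?_ (half_pos hβ0)
  have := mul_nonneg hβ0.le hE0
  linarith
end
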